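/- arXiv:1706.09949 — 4 statements merged into one kernel-verified Lean document; each statement's English description precedes it below -/
import Mathlib

section
/- There exists a universal constant c > 0 such that for all integers w ≥ 2 and d ≥ 1 the following holds: for every arrangement π_I of n = wd objects in which stacks 1 through w are full and stack w+1 is empty, and for every column-labeled goal g : O → {1,…,w} with exactly d objects assigned to each stack, the C-LSR instance (π_I, g) has a solution consisting of at most c · w · d · (1 + log w) permissible pop-and-push actions. -/
/-- An arrangement of `n` objects into `k` stacks of capacity `d`.
Depths are 0-based: Fin index `j` corresponds to depth `j+1`; index `0` is the top,
index `d-1` is the bottom (depth `d`). The occupied depths of every stack form a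
contiguous block containing the bottom. -/
structure Arrangement (n k d : ℕ) where
  pos : Fin n → Fin k × Fin d
  inj : Function.Injective pos
  contig : ∀ o : Fin n, ∀ j : Fin d, (pos o).2 ≤ j → ∃ o', pos o' = ((pos o).1, j)

/-- A permissible pop-and-push action: the top (minimal-depth) object `o` of a nonempty
stack is removed and pushed onto a different stack; all other objects stay put.
(Validity of the resulting `Arrangement` forces `o` to land on top of a stack that had
fewer than `d` objects.) -/
def Step {n k d : ℕ} (π π' : Arrangement n k d) : Prop :=
  ∃ o : Fin n,
    (π'.pos o).1 ≠ (π.pos o).1 ∧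
    (∀ o' : Fin n, o' ≠ o → (π.pos o').1 = (π.pos o).1 → (π.pos o).2 < (π.pos o').2) ∧
    (∀ o' : Fin n, o' ≠ o → π'.pos o' = π.pos o')

/-- `Reach π π' m`: the arrangement `π'` can be obtained from `π` by a sequence of
exactly `m` permissible pop-and-push actions. -/
def Reach {n k d : ℕ} (π π' : Arrangement n k d) (m : ℕ) : Prop :=
  ∃ f : ℕ → Arrangement n k d, f 0 = π ∧ f m = π' ∧ ∀ t, t < m → Step (f t) (f (t + 1))

/-- An arrangement of `n = w*d` objects in which stacks `1` through `w` are full and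
stack `w+1` is empty. -/
def StdFull {w d : ℕ} (π : Arrangement (w * d) (w + 1) d) : Prop :=
  (∀ o : Fin (w * d), ((π.pos o).1 : ℕ) < w) ∧
  (∀ i : Fin (w + 1), (i : ℕ) < w → ∀ j : Fin d, ∃ o, π.pos o = (i, j))

/-! ### Stacks as lists

A state assigns to every stack the list of its objects, top first. -/

theorem forall_of_sum_countP_eq {ι α : Type*} {d : ℕ} {S : Finset ι} {s : ι → List α}
    {p : α → Bool} (hlen : ∀ k ∈ S, (s k).length = d)
    (hsum : ∑ k ∈ S, (s k).countP p = S.card * d) : ∀ k ∈ S, ∀ o ∈ s k, p o = true := by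
  have h := (Finset.sum_eq_sum_iff_of_le (s := S) (f := fun k => (s k).countP p)
    (g := fun _ => d) fun k hk => (hlen k hk) ▸ List.countP_le_length).1 (by simpa using hsum)
  intro k hk
  exact List.countP_eq_length.1 ((h k hk).trans (hlen k hk).symm)

section ListModel

variable {ι α : Type*} [DecidableEq ι]

/-- Pop the top object of some stack and push it onto another stack holding fewer than `d`
objects. -/
def ListMove (d : ℕ) (s t : ι → List α) : Prop :=
  ∃ (x y : ι) (o : α) (L : List α), x ≠ y ∧ s x = o :: L ∧ (s y).length < d ∧
    t = Function.update (Function.update s x L) y (o :: s y)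

/-- `ListReach d m s t`: at most `m` moves lead from `s` to `t`. -/
inductive ListReach (d : ℕ) : ℕ → (ι → List α) → (ι → List α) → Prop
  | refl (m : ℕ) (s : ι → List α) : ListReach d m s s
  | cons {m : ℕ} {s t u : ι → List α} :
      ListMove d s t → ListReach d m t u → ListReach d (m + 1) s u

namespace ListReach

variable {d m n : ℕ} {s t u : ι → List α}

theorem mono (h : ListReach d m s t) (hmn : m ≤ n) : ListReach d n s t := by
  induction h generalizing n with
  | refl m s => exact refl n s
  | cons hm _ ih =>
    obtain ⟨n, rfl⟩ : ∃ n', n = n' + 1 := ⟨n - 1, by omega⟩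
    exact cons hm (ih (by omega))

theorem trans (h : ListReach d m s t) (h' : ListReach d n t u) : ListReach d (m + n) s u := by
  induction h with
  | refl m s => exact h'.mono (by omega)
  | @cons m _ _ _ hm _ ih =>
    rw [show m + 1 + n = m + n + 1 by omega]
    exact cons hm (ih h')

theorem sum_coe_eq [Fintype ι] (h : ListReach d m s t) :
    ∑ k, (s k : Multiset α) = ∑ k, (t k : Multiset α) := by
  induction h with
  | refl => rfl
  | @cons m s t u hm _ ih =>
    rw [← ih]
    obtain ⟨x, y, o, L, hxy, hx, -, rfl⟩ := hm
    have key : ∀ f : ι → List α, ∑ k, (f k : Multiset α) =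
        f x + (f y + ∑ k ∈ (Finset.univ.erase x).erase y, (f k : Multiset α)) := fun f => by
      rw [Finset.add_sum_erase _ (fun k => (f k : Multiset α)) (by simp [hxy.symm]),
        Finset.add_sum_erase _ (fun k => (f k : Multiset α)) (by simp)]
    rw [key s, key]
    have hrest : ∑ k ∈ (Finset.univ.erase x).erase y,
        ((Function.update (Function.update s x L) y (o :: s y)) k : Multiset α) =
        ∑ k ∈ (Finset.univ.erase x).erase y, (s k : Multiset α) := by
      refine Finset.sum_congr rfl fun k hk => ?_
      simp only [Finset.mem_erase] at hk
      simp [hk.1, hk.2.1]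
    rw [hrest, hx]
    simp [hxy, ← Multiset.cons_coe]

/-- The objects on a set `S` of stacks are preserved if all stacks off `S` are unchanged. -/
theorem sum_coe_eq_on [Fintype ι] (h : ListReach d m s t) (S : Finset ι)
    (hS : ∀ k ∉ S, t k = s k) :
    ∑ k ∈ S, (t k : Multiset α) = ∑ k ∈ S, (s k : Multiset α) := by
  have h1 := h.sum_coe_eq
  rw [← Finset.sum_add_sum_compl S, ← Finset.sum_add_sum_compl S (fun k => (t k : Multiset α))]
    at h1
  have h2 : ∑ k ∈ Sᶜ, (t k : Multiset α) = ∑ k ∈ Sᶜ, (s k : Multiset α) :=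
    Finset.sum_congr rfl fun k hk => by rw [hS k (by simpa using hk)]
  rw [h2] at h1
  exact (add_right_cancel h1).symm

theorem sum_countP_eq_on [Fintype ι] (h : ListReach d m s t) (S : Finset ι)
    (hS : ∀ k ∉ S, t k = s k) (p : α → Bool) :
    ∑ k ∈ S, (t k).countP p = ∑ k ∈ S, (s k).countP p := by
  have h1 := congrArg (Multiset.countPAddMonoidHom (fun a => p a = true)) (h.sum_coe_eq_on S hS)
  simpa [map_sum] using h1

end ListReach

variable {d : ℕ}

/-- Move the top part `L` of stack `x` onto stack `y`. -/
theorem exists_listReach_move {x y : ι} (hxy : x ≠ y) (L R : List α) (s : ι → List α)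
    (hx : s x = L ++ R) (hy : (s y).length + L.length ≤ d) :
    ∃ t, ListReach d L.length s t ∧ t x = R ∧ t y = L.reverse ++ s y ∧
      ∀ k, k ≠ x → k ≠ y → t k = s k := by
  induction L generalizing s with
  | nil => exact ⟨s, .refl _ _, by simpa using hx, by simp, fun _ _ _ => rfl⟩
  | cons o L ih =>
    simp only [List.length_cons] at hy
    obtain ⟨t, ht, htx, hty, htk⟩ :=
      ih (Function.update (Function.update s x (L ++ R)) y (o :: s y))
        (by simp [hxy]) (by simp; omega)
    refine ⟨t, .cons ⟨x, y, o, L ++ R, hxy, by simpa using hx, by omega, rfl⟩ ht, htx, ?_, ?_⟩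
    · simpa using hty
    · intro k hkx hky
      rw [htk k hkx hky]
      simp [hkx, hky]

/-- Distribute the content of stack `x` onto the stacks `y` and `z` according to `p`. -/
theorem exists_listReach_distribute {x y z : ι} (hxy : x ≠ y) (hxz : x ≠ z) (hyz : y ≠ z)
    (p : α → Bool) (L : List α) (s : ι → List α) (hx : s x = L)
    (hy : (s y).length + (L.filter p).length ≤ d)
    (hz : (s z).length + (L.filter (!p ·)).length ≤ d) :
    ∃ t, ListReach d L.length s t ∧ t x = [] ∧ t y = (L.filter p).reverse ++ s y ∧
      t z = (L.filter (!p ·)).reverse ++ s z ∧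
      ∀ k, k ≠ x → k ≠ y → k ≠ z → t k = s k := by
  induction L generalizing s with
  | nil => exact ⟨s, .refl _ _, hx, by simp, by simp, fun _ _ _ _ => rfl⟩
  | cons o L ih =>
    by_cases ho : p o = true
    · simp only [ho, List.filter_cons, if_true, Bool.not_true, Bool.false_eq_true, if_false,
        List.length_cons] at hy hz
      obtain ⟨t, ht, htx, hty, htz, htk⟩ :=
        ih (Function.update (Function.update s x L) y (o :: s y))
          (by simp [hxy]) (by simp; omega) (by simpa [hyz.symm, hxz.symm] using hz)
      refine ⟨t, .cons ⟨x, y, o, L, hxy, hx, by omega, rfl⟩ ht, htx, ?_, ?_, ?_⟩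
      · simpa [ho] using hty
      · simpa [ho, hyz.symm, hxz.symm] using htz
      · intro k hkx hky hkz
        rw [htk k hkx hky hkz]
        simp [hkx, hky]
    · simp only [ho, List.filter_cons, if_true, Bool.false_eq_true, if_false, List.length_cons,
        Bool.not_false] at hy hz
      obtain ⟨t, ht, htx, hty, htz, htk⟩ :=
        ih (Function.update (Function.update s x L) z (o :: s z))
          (by simp [hxz]) (by simpa [hyz, hxy.symm] using hy) (by simp; omega)
      refine ⟨t, .cons ⟨x, z, o, L, hxz, hx, by omega, rfl⟩ ht, htx, ?_, ?_, ?_⟩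
      · simpa [ho, hyz, hxy.symm] using hty
      · simpa [ho] using htz
      · intro k hkx hky hkz
        rw [htk k hkx hky hkz]
        simp [hkx, hkz]

/-- With a full stack `y` and an empty stack `e` at hand, a full stack `x` can be reordered so
that the objects satisfying `p` are on top. -/
theorem exists_listReach_sort {x y e : ι} (hxy : x ≠ y) (hxe : x ≠ e) (hye : y ≠ e)
    (p : α → Bool) (s : ι → List α) (hx : (s x).length = d) (hy : (s y).length = d)
    (he : s e = []) :
    ∃ t, ListReach d (4 * d) s t ∧ t x = (s x).filter p ++ (s x).filter (!p ·) ∧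
      ∀ k, k ≠ x → t k = s k := by
  set P := (s x).filter p with hP
  set N := (s x).filter (!p ·) with hN
  have hPN : P.length + N.length = d := by
    rw [← hx, (s x).length_eq_length_filter_add p]
  obtain ⟨U, V, hUV, hU⟩ : ∃ U V, s y = U ++ V ∧ U.length = P.length :=
    ⟨(s y).take P.length, (s y).drop P.length, by simp, by simp; omega⟩
  have hV : U.length + V.length = d := by rw [← hy, hUV]; simp
  obtain ⟨t₁, r₁, y₁, e₁, k₁⟩ := exists_listReach_move (d := d) hye U V s hUV (by simp [he]; omega)
  obtain ⟨t₂, r₂, x₂, y₂, e₂, k₂⟩ := exists_listReach_distribute (d := d) hxy hxe hye p (s x) t₁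
    (k₁ x hxy hxe) (by rw [y₁, ← hP]; omega) (by simp [e₁, he, ← hN]; omega)
  rw [← hP] at y₂
  rw [← hN] at e₂
  obtain ⟨t₃, r₃, e₃, x₃, k₃⟩ := exists_listReach_move (d := d) hxe.symm N.reverse (t₁ e) t₂ e₂
    (by simp [x₂]; omega)
  obtain ⟨t₄, r₄, y₄, x₄, k₄⟩ := exists_listReach_move (d := d) hxy.symm P.reverse (t₁ y) t₃
    (by rw [k₃ y hye hxy.symm, y₂]) (by simp [x₃, x₂]; omega)
  obtain ⟨t₅, r₅, e₅, y₅, k₅⟩ := exists_listReach_move (d := d) hye.symm U.reverse [] t₄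
    (by rw [k₄ e hye.symm hxe.symm, e₃, e₁, he]) (by simp [y₄, y₁]; omega)
  refine ⟨t₅, ((((r₁.trans r₂).trans r₃).trans r₄).trans r₅).mono ?_, ?_, ?_⟩
  · simp; omega
  · rw [k₅ x hxe hxy, x₄, x₃, x₂]; simp
  · intro k hkx
    by_cases hky : k = y
    · subst hky; rw [y₅, y₄, y₁, hUV]; simp
    by_cases hke : k = e
    · subst hke; rw [e₅, he]
    rw [k₅ k hke hky, k₄ k hky hkx, k₃ k hke hkx, k₂ k hkx hky hke, k₁ k hky hke]

/-- If two full stacks `x` and `y` together hold at least `d` objects satisfying `p`, then `x` can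
be filled with such objects. -/
theorem exists_listReach_fill {x y e : ι} (hxy : x ≠ y) (hxe : x ≠ e) (hye : y ≠ e)
    (p : α → Bool) (s : ι → List α) (hx : (s x).length = d) (hy : (s y).length = d)
    (he : s e = []) (hp : d ≤ (s x).countP p + (s y).countP p) :
    ∃ t, ListReach d (11 * d) s t ∧ (∀ o ∈ t x, p o = true) ∧ (t x).length = d ∧
      (t y).length = d ∧ ∀ k, k ≠ x → k ≠ y → t k = s k := by
  obtain ⟨t₁, r₁, x₁, k₁⟩ := exists_listReach_sort (d := d) hxy hxe hye p s hx hy he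
  have hPN := (s x).length_eq_length_filter_add p
  have hPN' := (s y).length_eq_length_filter_add p
  obtain ⟨t₂, r₂, y₂, k₂⟩ := exists_listReach_sort (d := d) hxy.symm hye hxe p t₁
    (by rw [k₁ y hxy.symm, hy]) (by rw [x₁, List.length_append]; omega)
    (by rw [k₁ e hxe.symm, he])
  rw [k₁ y hxy.symm] at y₂
  rw [List.countP_eq_length_filter, List.countP_eq_length_filter] at hp
  set P := (s x).filter p with hP
  set N := (s x).filter (!p ·) with hN
  set P' := (s y).filter p with hP'
  set N' := (s y).filter (!p ·) with hN'
  have he₂ : t₂ e = [] := by rw [k₂ e hye.symm, k₁ e hxe.symm, he]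
  obtain ⟨t₃, r₃, x₃, e₃, k₃⟩ := exists_listReach_move (d := d) hxe P N t₂
    (by rw [k₂ x hxy, x₁]) (by simp [he₂]; omega)
  obtain ⟨t₄, r₄, y₄, e₄, k₄⟩ := exists_listReach_move (d := d) hye (P'.take (d - P.length))
    (P'.drop (d - P.length) ++ N') t₃
    (by rw [k₃ y hxy.symm hye, y₂, ← List.append_assoc, List.take_append_drop])
    (by simp [e₃, he₂]; omega)
  have hx₄ : t₄ x = N := by rw [k₄ x hxy hxe, x₃]
  obtain ⟨t₅, r₅, x₅, y₅, k₅⟩ := exists_listReach_move (d := d) hxy N [] t₄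
    (by simp [hx₄]) (by simp [y₄]; omega)
  obtain ⟨t₆, r₆, e₆, x₆, k₆⟩ := exists_listReach_move (d := d) hxe.symm (t₄ e) [] t₅
    (by simp [k₅ e hxe.symm hye.symm]) (by simp [x₅, e₄, e₃, he₂]; omega)
  refine ⟨t₆, (((((r₁.trans r₂).trans r₃).trans r₄).trans r₅).trans r₆).mono ?_, ?_, ?_, ?_, ?_⟩
  · simp [e₄, e₃, he₂]; omega
  · intro o ho
    have hmem : o ∈ P' ∨ o ∈ P := by
      simp only [x₆, x₅, e₄, e₃, he₂, List.append_nil, List.mem_reverse, List.mem_append] at ho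
      exact ho.imp List.mem_of_mem_take id
    rcases hmem with h | h
    · exact (List.mem_filter.1 h).2
    · exact (List.mem_filter.1 h).2
  · simp [x₆, x₅, e₄, e₃, he₂]; omega
  · simp [k₆ y hye hxy.symm, y₅, y₄]; omega
  · intro k hkx hky
    by_cases hke : k = e
    · subst hke; rw [e₆, he]
    rw [k₆ k hke hkx, k₅ k hkx hky, k₄ k hky hke, k₃ k hkx hke, k₂ k hky, k₁ k hkx]

/-- Two-colour sorting: the objects satisfying `p` can be gathered on the stacks of `A ⊆ S`, at a
cost linear in the number of misfilled stacks. -/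
theorem exists_listReach_partition_aux [Fintype ι] {e : ι} {S A : Finset ι} (heS : e ∉ S)
    (hAS : A ⊆ S) (p : α → Bool) (n : ℕ) (s : ι → List α) (hlen : ∀ k ∈ S, (s k).length = d)
    (he : s e = []) (hsum : ∑ k ∈ S, (s k).countP p = A.card * d)
    (hn : ∃ B ⊆ S, B.card ≤ n ∧ ∀ k ∈ S, k ∉ B → ∀ o ∈ s k, p o = decide (k ∈ A)) :
    ∃ t, ListReach d (11 * d * n) s t ∧ (∀ k ∈ S, (t k).length = d) ∧
      (∀ k ∈ S, ∀ o ∈ t k, p o = decide (k ∈ A)) ∧ ∀ k ∉ S, t k = s k := by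
  induction n generalizing s with
  | zero =>
    obtain ⟨B, -, hB, h⟩ := hn
    obtain rfl : B = ∅ := by simpa using hB
    exact ⟨s, .refl _ _, hlen, fun k hk => h k hk (by simp), fun _ _ => rfl⟩
  | succ n ih =>
    obtain ⟨B, hBS, hB, hcor⟩ := hn
    by_cases hall : ∀ k ∈ S, ∀ o ∈ s k, p o = decide (k ∈ A)
    · exact ⟨s, .refl _ _, hlen, hall, fun _ _ => rfl⟩
    have hsplit := Finset.sum_sdiff (f := fun k => (s k).countP p) hAS
    rw [hsum] at hsplit
    have hi : ∃ i ∈ A, ¬ ∀ o ∈ s i, p o = true := by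
      by_contra! hA
      refine hall fun k hk o ho => ?_
      by_cases hkA : k ∈ A
      · simpa [hkA] using hA k hkA o ho
      have hA' : ∑ k ∈ A, (s k).countP p = A.card * d := by
        rw [Finset.sum_const_nat fun k hk =>
          (List.countP_eq_length.2 (hA k hk)).trans (hlen k (hAS hk))]
      have h0 : ∑ k ∈ S \ A, (s k).countP p = 0 := by omega
      rw [Finset.sum_eq_zero_iff] at h0
      have := List.countP_eq_zero.1 (h0 k (by simp [hk, hkA])) o ho
      simpa [hkA] using this
    have hj : ∃ j ∈ S \ A, ¬ ∀ o ∈ s j, (!p o) = true := by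
      by_contra! hA
      refine hall fun k hk o ho => ?_
      by_cases hkA : k ∈ A
      · have h0 : ∑ k ∈ S \ A, (s k).countP p = 0 :=
          Finset.sum_eq_zero fun k hk => List.countP_eq_zero.2 (by simpa using hA k hk)
        have := forall_of_sum_countP_eq (p := p) (fun k hk => hlen k (hAS hk)) (by omega)
          k hkA o ho
        simpa [hkA] using this
      · simpa [hkA] using hA k (by simp [hk, hkA]) o ho
    obtain ⟨i, hiA, hi⟩ := hi
    obtain ⟨j, hj', hj⟩ := hj
    obtain ⟨hjS, hjA⟩ := Finset.mem_sdiff.1 hj'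
    have hiS := hAS hiA
    have hij : i ≠ j := by rintro rfl; exact hjA hiA
    have hie : i ≠ e := by rintro rfl; exact heS hiS
    have hje : j ≠ e := by rintro rfl; exact heS hjS
    have hiB : i ∈ B := by
      by_contra h
      exact hi (by simpa [hiA] using hcor i hiS h)
    have hjB : j ∈ B := by
      by_contra h
      exact hj (by simpa [hjA] using hcor j hjS h)
    obtain ⟨t, b, ht, hbB, hbt, hti, htj, htk⟩ : ∃ t b, ListReach d (11 * d) s t ∧ b ∈ B ∧
        (∀ o ∈ t b, p o = decide (b ∈ A)) ∧ (t i).length = d ∧ (t j).length = d ∧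
        ∀ k, k ≠ i → k ≠ j → t k = s k := by
      by_cases hc : d ≤ (s i).countP p + (s j).countP p
      · obtain ⟨t, r, h, hti, htj, htk⟩ := exists_listReach_fill hij hie hje p s (hlen i hiS)
          (hlen j hjS) he hc
        exact ⟨t, i, r, hiB, by simpa [hiA] using h, hti, htj, htk⟩
      · have h1 := (s i).length_eq_countP_add_countP p
        have h2 := (s j).length_eq_countP_add_countP p
        rw [hlen i hiS] at h1
        rw [hlen j hjS] at h2
        obtain ⟨t, r, h, htj, hti, htk⟩ := exists_listReach_fill hij.symm hje hie (!p ·) s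
          (hlen j hjS) (hlen i hiS) he (by simp at h1 h2 ⊢; omega)
        exact ⟨t, j, r, hjB, by simpa [hjA] using h, hti, htj, fun k h h' => htk k h' h⟩
    have htS : ∀ k ∉ S, t k = s k := fun k hk =>
      htk k (by rintro rfl; exact hk hiS) (by rintro rfl; exact hk hjS)
    obtain ⟨u, hu, hulen, hup, huk⟩ := ih t
      (fun k hk => by
        by_cases h1 : k = i
        · rw [h1, hti]
        by_cases h2 : k = j
        · rw [h2, htj]
        rw [htk k h1 h2, hlen k hk])
      (by rw [htS e heS, he]) (by rw [ht.sum_countP_eq_on S htS, hsum])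
      ⟨B.erase b, (Finset.erase_subset _ _).trans hBS,
        by rw [Finset.card_erase_of_mem hbB]; omega, fun k hk hkB => by
          by_cases hkb : k = b
          · rwa [hkb]
          have hkB' : k ∉ B := fun h => hkB (Finset.mem_erase.2 ⟨hkb, h⟩)
          rw [htk k (by rintro rfl; exact hkB' hiB) (by rintro rfl; exact hkB' hjB)]
          exact hcor k hk hkB'⟩
    exact ⟨u, (ht.trans hu).mono (by rw [Nat.mul_succ]; omega), hulen, hup,
      fun k hk => by rw [huk k hk, htS k hk]⟩

/-- Sort the objects on the full stacks `S` according to their labels `g`, using one empty stack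
`e`, by repeatedly halving `S`. -/
theorem exists_listReach_sort_labels [Fintype ι] {e : ι} (g : α → ι) (c : ℕ) (S : Finset ι)
    (hc : S.card ≤ 2 ^ c) (heS : e ∉ S) (s : ι → List α) (hlen : ∀ k ∈ S, (s k).length = d)
    (he : s e = []) (hsum : ∀ j ∈ S, ∑ k ∈ S, (s k).countP (g · = j) = d) :
    ∃ t, ListReach d (11 * d * S.card * c) s t ∧ (∀ k ∈ S, ∀ o ∈ t k, g o = k) ∧
      ∀ k ∉ S, t k = s k := by
  induction c generalizing S s with
  | zero =>
    refine ⟨s, .refl _ _, ?_, fun _ _ => rfl⟩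
    intro k hk
    obtain rfl : S = {k} := by
      refine (Finset.eq_of_subset_of_card_le (by simpa using hk) (by simpa using hc)).symm
    intro o ho
    exact of_decide_eq_true
      (forall_of_sum_countP_eq hlen (by simpa using hsum k hk) k hk o ho)
  | succ c ih =>
    obtain ⟨A, hAS, hA⟩ := Finset.exists_subset_card_eq (Nat.div_le_self S.card 2)
    rw [pow_succ] at hc
    have hAc := Finset.card_sdiff_add_card_eq_card hAS
    have hcount : ∀ L : List α, ∀ T : Finset ι,
        L.countP (fun o => decide (g o ∈ T)) = ∑ j ∈ T, L.countP (g · = j) := by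
      intro L T
      induction L with
      | nil => simp
      | cons o L ihL => simp [List.countP_cons, ihL, Finset.sum_add_distrib]
    obtain ⟨t, ht, htlen, htA, htk⟩ := exists_listReach_partition_aux heS hAS
      (fun o => decide (g o ∈ A)) S.card s hlen he
      (by
        simp only [hcount]
        rw [Finset.sum_comm, Finset.sum_const_nat fun j hj => hsum j (hAS hj)])
      ⟨S, subset_rfl, le_rfl, fun k h h' => absurd h h'⟩
    have htsum : ∀ j ∈ S, ∑ k ∈ S, (t k).countP (g · = j) = d := fun j hj => by
      rw [ht.sum_countP_eq_on S htk, hsum j hj]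
    have hzero : ∀ k ∈ S, ∀ j, (j ∈ A ↔ k ∉ A) → (t k).countP (g · = j) = 0 := by
      intro k hk j hj
      refine List.countP_eq_zero.2 fun o ho => ?_
      have := htA k hk o ho
      simp only [decide_eq_decide] at this
      simp only [decide_eq_true_eq]
      rintro rfl
      tauto
    obtain ⟨u, hu, huA, huk⟩ := ih A (by omega) (fun h => heS (hAS h)) t
      (fun k hk => htlen k (hAS hk)) (by rw [htk e heS, he])
      (fun j hj => by
        rw [← htsum j (hAS hj)]
        refine Finset.sum_subset hAS fun k hk hkA => hzero k hk j (by tauto))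
    have heA : e ∉ A := fun h => heS (hAS h)
    have hu' : ∀ k ∈ S \ A, u k = t k := fun k hk => huk k (Finset.mem_sdiff.1 hk).2
    obtain ⟨v, hv, hvA, hvk⟩ := ih (S \ A) (by omega) (by simp [heS]) u
      (fun k hk => by rw [hu' k hk, htlen k (Finset.mem_sdiff.1 hk).1])
      (by rw [huk e heA, htk e heS, he])
      (fun j hj => by
        rw [Finset.sum_congr rfl fun k hk => by rw [hu' k hk]]
        obtain ⟨hjS, hjA⟩ := Finset.mem_sdiff.1 hj
        rw [← htsum j hjS]
        refine Finset.sum_subset Finset.sdiff_subset fun k hk hkA => hzero k hk j ?_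
        simp only [Finset.mem_sdiff] at hkA
        tauto)
    refine ⟨v, ((ht.trans hu).trans hv).mono (le_of_eq ?_), ?_, ?_⟩
    · rw [← hAc]; ring
    · intro k hk
      by_cases hkA : k ∈ A
      · rw [hvk k (by simp [hkA])]
        exact huA k hkA
      · exact hvA k (by simp [hk, hkA])
    · intro k hk
      rw [hvk k (by simp [hk]), huk k (fun h => hk (hAS h)), htk k hk]

end ListModel

/-! ### Realising list states by arrangements -/

section Realise

variable {n k d : ℕ}

/-- The positions `f` place the objects as prescribed by the list state `s`. -/
structure Realises (f : Fin n → Fin k × Fin d) (s : Fin k → List (Fin n)) : Prop where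
  length_le : ∀ i, (s i).length ≤ d
  eq_iff : ∀ o i j, f o = (i, j) ↔ (s i).reverse[(j.rev : ℕ)]? = some o

namespace Realises

variable {f : Fin n → Fin k × Fin d} {s t : Fin k → List (Fin n)}

/-- Positions realising a list state form an arrangement. -/
def arrangement (h : Realises f s) : Arrangement n k d where
  pos := f
  inj o o' hoo := by
    have h1 := (h.eq_iff o _ _).1 rfl
    have h2 := (h.eq_iff o' _ _).1 hoo.symm
    exact Option.some_injective _ (h1.symm.trans h2)
  contig o j hj := by
    obtain ⟨h2, -⟩ := List.getElem?_eq_some_iff.1 ((h.eq_iff o _ _).1 rfl)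
    have h3 : (j.rev : ℕ) < (s (f o).1).reverse.length := by
      have : (f o).2.val ≤ j.val := hj
      simp only [Fin.val_rev] at h2 ⊢
      omega
    exact ⟨_, (h.eq_iff _ _ _).2 (List.getElem?_eq_getElem h3)⟩

theorem getElem?_eq_some_iff (h : Realises f s) {o : Fin n} {i : Fin k} {m : ℕ} :
    (s i).reverse[m]? = some o ↔ (f o).1 = i ∧ ((f o).2.rev : ℕ) = m := by
  constructor
  · intro hm
    have hmd : m < d := by
      obtain ⟨h1, -⟩ := List.getElem?_eq_some_iff.1 hm
      have := h.length_le i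
      simp only [List.length_reverse] at h1
      omega
    rw [(h.eq_iff o i (Fin.rev ⟨m, hmd⟩)).2 (by simpa using hm)]
    simp
  · rintro ⟨rfl, rfl⟩
    exact (h.eq_iff o _ _).1 rfl

theorem mem_iff (h : Realises f s) {o : Fin n} {i : Fin k} : o ∈ s i ↔ (f o).1 = i := by
  rw [← List.mem_reverse, List.mem_iff_getElem?]
  simp [h.getElem?_eq_some_iff]

theorem exists_step {π : Arrangement n k d} (h : Realises π.pos s) (hst : ListMove d s t) :
    ∃ π' : Arrangement n k d, Step π π' ∧ Realises π'.pos t := by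
  obtain ⟨x, y, o, L, hxy, hx, hy, rfl⟩ := hst
  have hLd : L.length + 1 ≤ d := by simpa [hx] using h.length_le x
  have ho := h.getElem?_eq_some_iff (o := o) (i := x) (m := L.length)
  simp only [hx, List.reverse_cons, ← List.length_reverse (as := L), List.getElem?_concat_length,
    true_iff] at ho
  have hL : ∀ (o' : Fin n) (m : ℕ), L.reverse[m]? = some o' ↔
      o' ≠ o ∧ (s x).reverse[m]? = some o' := by
    intro o' m
    have h1 := h.getElem?_eq_some_iff (o := o) (i := x) (m := m)
    rw [hx, List.reverse_cons] at h1 ⊢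
    rcases lt_trichotomy m L.reverse.length with hm | hm | hm
    · rw [List.getElem?_append_left hm] at h1 ⊢
      refine ⟨fun h2 => ⟨?_, h2⟩, fun h2 => h2.2⟩
      rintro rfl
      have := (h1.1 h2).2
      omega
    · subst hm
      simp [eq_comm]
    · rw [List.getElem?_eq_none hm.le, List.getElem?_eq_none (by simpa using hm)]
      simp
  have hR : Realises (Function.update π.pos o (y, (⟨(s y).length, hy⟩ : Fin d).rev))
      (Function.update (Function.update s x L) y (o :: s y)) := by
    refine ⟨fun i => ?_, fun o' i j => ?_⟩
    · by_cases hiy : i = y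
      · subst hiy; simpa using hy
      by_cases hix : i = x
      · subst hix; simp [hxy]; omega
      simpa [hiy, hix] using h.length_le i
    · have ho'y : ∀ m, (s y).reverse[m]? ≠ some o := fun m hm =>
        hxy (ho.1.symm.trans (h.getElem?_eq_some_iff.1 hm).1)
      by_cases hiy : i = y
      · subst hiy
        rw [Function.update_self, List.reverse_cons]
        have hrev : ∀ l : Fin d, l = j ↔ (l.rev : ℕ) = j.rev := fun l => by
          rw [Fin.val_inj, Fin.rev_inj]
        by_cases hoo : o' = o
        · subst hoo
          rw [Function.update_self, Prod.mk.injEq, hrev, Fin.rev_rev]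
          simp only [true_and]
          rcases lt_trichotomy (j.rev : ℕ) (s i).reverse.length with hm | hm | hm
          · rw [List.getElem?_append_left hm]
            simp only [List.length_reverse] at hm
            exact ⟨fun h1 => absurd h1 hm.ne', fun h1 => absurd h1 (ho'y _)⟩
          · rw [hm]
            simp
          · rw [List.getElem?_eq_none (by simpa using hm)]
            simp only [List.length_reverse] at hm
            simpa only [reduceCtorEq, iff_false] using hm.ne
        · rw [Function.update_of_ne hoo, h.eq_iff]
          rcases lt_trichotomy (j.rev : ℕ) (s i).reverse.length with hm | hm | hm
          · rw [List.getElem?_append_left hm]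
          · rw [hm]
            simp [Ne.symm hoo]
          · rw [List.getElem?_eq_none hm.le, List.getElem?_eq_none (by simpa using hm)]
      by_cases hix : i = x
      · subst hix
        rw [Function.update_of_ne hxy, Function.update_self, hL, ← h.eq_iff]
        by_cases hoo : o' = o <;> simp [hoo, Ne.symm hxy]
      · rw [Function.update_of_ne hiy, Function.update_of_ne hix, ← h.eq_iff]
        by_cases hoo : o' = o
        · subst hoo
          simp only [Function.update_self, Prod.mk.injEq, Ne.symm hiy, false_and, false_iff]
          intro h1
          rw [h1] at ho
          exact hix ho.1
        · simp [hoo]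
  refine ⟨hR.arrangement, ⟨o, ?_, ?_, ?_⟩, hR⟩
  · simp [arrangement, ho.1, hxy.symm]
  · intro o' ho' hst
    have h1 := (hL o' _).2 ⟨ho', h.getElem?_eq_some_iff.2 ⟨hst.trans ho.1, rfl⟩⟩
    obtain ⟨h2, -⟩ := List.getElem?_eq_some_iff.1 h1
    rw [← ho.2] at h2
    exact Fin.rev_lt_rev.1 h2
  · intro o' ho'
    simp [arrangement, ho']

theorem exists_reach {m : ℕ} {π : Arrangement n k d} (h : Realises π.pos s)
    (hst : ListReach d m s t) :
    ∃ m' ≤ m, ∃ π' : Arrangement n k d, Reach π π' m' ∧ Realises π'.pos t := by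
  induction hst generalizing π with
  | refl m s => exact ⟨0, Nat.zero_le _, π, ⟨fun _ => π, rfl, rfl, by simp⟩, h⟩
  | cons hm _ ih =>
    obtain ⟨π₁, hstep, h₁⟩ := h.exists_step hm
    obtain ⟨m', hm', π', ⟨F, hF0, hFm, hF⟩, h'⟩ := ih h₁
    refine ⟨m' + 1, by omega, π', ⟨fun i => Nat.casesOn i π F, rfl, hFm, ?_⟩, h'⟩
    rintro (_ | i) hi
    · simpa [hF0] using hstep
    · exact hF i (by omega)

/-- Summing a count over all stacks counts objects. -/
theorem sum_countP (h : Realises f s) (p : Fin n → Prop) [DecidablePred p] :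
    ∑ i, (s i).countP (fun o => decide (p o)) = (Finset.univ.filter p).card := by
  have hnd : ∀ i, (s i).Nodup := fun i => by
    rw [← List.nodup_reverse, List.nodup_iff_getElem?_ne_getElem?]
    intro a b hab hb heq
    rw [List.getElem?_eq_getElem hb, h.getElem?_eq_some_iff] at heq
    have := h.getElem?_eq_some_iff.1 (List.getElem?_eq_getElem hb)
    omega
  have hcount : ∑ i, (s i : Multiset (Fin n)) = (Finset.univ : Finset (Fin n)).val := by
    ext o
    rw [Multiset.count_sum', Multiset.count_eq_one_of_mem Finset.univ.nodup (by simp),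
      Finset.sum_eq_single (f o).1]
    · simpa using List.count_eq_one_of_mem (hnd _) (h.mem_iff.2 rfl)
    · intro i _ hi
      simpa [List.count_eq_zero, h.mem_iff] using hi.symm
    · simp
  have h1 := congrArg (Multiset.countPAddMonoidHom p) hcount
  rw [map_sum] at h1
  simpa [Finset.card, Finset.filter, Multiset.countP_eq_card_filter,
    List.countP_eq_length_filter] using h1

end Realises

theorem StdFull.exists_realises {w d : ℕ} {π : Arrangement (w * d) (w + 1) d} (h : StdFull π) :
    ∃ s, Realises π.pos s ∧ s (Fin.last w) = [] ∧ ∀ i : Fin (w + 1), (i : ℕ) < w →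
      (s i).length = d := by
  obtain ⟨h1, h2⟩ := h
  choose obj hobj using h2
  refine ⟨fun i => if hi : (i : ℕ) < w then List.ofFn (obj i hi) else [], ⟨?_, ?_⟩, ?_, ?_⟩
  · intro i
    by_cases hi : (i : ℕ) < w <;> simp [hi]
  · intro o i j
    by_cases hi : (i : ℕ) < w
    · simp only [hi, dif_pos]
      rw [List.getElem?_reverse (by simp only [List.length_ofFn, Fin.is_lt])]
      have hidx : (List.ofFn (obj i hi)).length - 1 - (j.rev : ℕ) = j := by
        simp only [List.length_ofFn, Fin.val_rev]
        omega
      rw [hidx, List.getElem?_eq_getElem (by simp), List.getElem_ofFn, ← hobj i hi j]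
      simp only [Option.some.injEq]
      exact ⟨fun h3 => (π.inj h3).symm, fun h3 => by rw [← h3]⟩
    · simp only [hi, dif_neg, not_false_eq_true, List.reverse_nil, List.getElem?_nil,
        reduceCtorEq, iff_false]
      intro h3
      have := h1 o
      rw [h3] at this
      exact hi this
  · simp
  · intro i hi
    simp [hi]

end Realise

/-- There is a universal constant `c > 0` such that for all `w ≥ 2`, `d ≥ 1`:
for every arrangement `π_I` of `n = w*d` objects with stacks `1..w` full and stack `w+1`
empty, and every column-labeled goal `g : O → {1,…,w}` assigning exactly `d` objects to
each of the stacks `1..w`, the C-LSR instance `(π_I, g)` has a solution of at most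
`c·w·d·(1 + log w)` permissible pop-and-push actions. -/
theorem clsr_upper_bound :
    ∃ c : ℝ, 0 < c ∧ ∀ w d : ℕ, 2 ≤ w → 1 ≤ d →
      ∀ πI : Arrangement (w * d) (w + 1) d, StdFull πI →
        ∀ g : Fin (w * d) → Fin (w + 1),
          (∀ o, ((g o : ℕ) < w)) →
          (∀ i : Fin (w + 1), (i : ℕ) < w →
            (Finset.univ.filter fun o => g o = i).card = d) →
          ∃ m : ℕ, (m : ℝ) ≤ c * w * d * (1 + Real.log w) ∧
            ∃ π' : Arrangement (w * d) (w + 1) d,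
              Reach πI π' m ∧ ∀ o, (π'.pos o).1 = g o := by
  refine ⟨22, by norm_num, fun w d hw hd πI hI g hg hcard => ?_⟩
  obtain ⟨s, hs, he, hlen⟩ := hI.exists_realises
  have hlast : ∀ k : Fin (w + 1), k ∈ Finset.univ.erase (Fin.last w) ↔ (k : ℕ) < w := fun k => by
    simp [Fin.lt_last_iff_ne_last.symm, Fin.lt_def]
  have hS : (Finset.univ.erase (Fin.last w)).card = w := by simp
  obtain ⟨t, ht, htg, htk⟩ := exists_listReach_sort_labels (d := d) g (Nat.clog 2 w)
    (Finset.univ.erase (Fin.last w)) (hS.le.trans (Nat.le_pow_clog (by norm_num) w)) (by simp) s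
    (fun k hk => hlen k ((hlast k).1 hk)) he (fun j hj => by
      rw [Finset.sum_erase _ (by simp [he]), hs.sum_countP, hcard j ((hlast j).1 hj)])
  rw [hS] at ht
  obtain ⟨m, hm, π', hreach, h'⟩ := hs.exists_reach ht
  refine ⟨m, ?_, π', hreach, fun o => ?_⟩
  · have hclog : (Nat.clog 2 w : ℝ) ≤ 2 * (1 + Real.log w) := by
      rw [← Real.natCeil_logb_natCast]
      have hlog : 0 ≤ Real.log w := Real.log_natCast_nonneg w
      have h2 := Real.log_two_gt_d9
      have hdiv : Real.logb (2 : ℕ) w ≤ 2 * Real.log w := by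
        rw [Real.logb, Nat.cast_ofNat, div_le_iff₀ (by linarith)]
        nlinarith
      have := Nat.ceil_lt_add_one (a := Real.logb (2 : ℕ) w) (div_nonneg hlog (by simp; linarith))
      linarith
    calc (m : ℝ) ≤ ((11 * d * w * Nat.clog 2 w : ℕ) : ℝ) := by exact_mod_cast hm
      _ = 11 * w * d * (Nat.clog 2 w : ℝ) := by push_cast; ring
      _ ≤ 11 * w * d * (2 * (1 + Real.log w)) := by gcongr
      _ = 22 * w * d * (1 + Real.log w) := by ring
  · have ho := h'.mem_iff.2 (rfl : (π'.pos o).1 = _)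
    refine (htg _ ?_ o ho).symm
    simp only [Finset.mem_erase, Finset.mem_univ, and_true]
    intro hlast
    rw [hlast, htk _ (by simp), he] at ho
    simp at ho
end

section
/- There exists a universal constant c > 0 such that the following holds for every integer d ≥ 1. Consider an arrangement of 2d objects into three stacks of capacity d in which stacks 1 and 2 are full and stack 3 is empty, and let each object of stack 1 carry one of two labels L or R. Then there is a sequence of at most c·d permissible pop-and-push actions after which stack 1 contains exactly its original objects with all L-labeled objects occupying a contiguous block of depths below all R-labeled objects, stack 2 contains exactly its original set of objects, and stack 3 is empty. -/
theorem Reach.refl {n k d : ℕ} (π : Arrangement n k d) : Reach π π 0 :=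
  ⟨fun _ => π, rfl, rfl, fun _ h => absurd h (Nat.not_lt_zero _)⟩

theorem Step.reach {n k d : ℕ} {π π' : Arrangement n k d} (h : Step π π') : Reach π π' 1 := by
  refine ⟨fun t => if t = 0 then π else π', by simp, by simp, fun t ht => ?_⟩
  obtain rfl : t = 0 := by omega
  simpa using h

theorem Reach.trans {n k d : ℕ} {π₁ π₂ π₃ : Arrangement n k d} {a b : ℕ}
    (h₁ : Reach π₁ π₂ a) (h₂ : Reach π₂ π₃ b) : Reach π₁ π₃ (a + b) := by
  obtain ⟨f, f0, fa, hf⟩ := h₁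
  obtain ⟨g, g0, gb, hg⟩ := h₂
  refine ⟨fun t => if t < a then f t else g (t - a), ?_, ?_, fun t ht => ?_⟩
  · rcases Nat.eq_zero_or_pos a with rfl | ha
    · simp [g0, ← fa, f0]
    · simp [ha, f0]
  · simp [gb]
  · rcases lt_trichotomy (t + 1) a with h | h | h
    · simpa [h, (Nat.lt_succ_self t).trans h] using hf t (by omega)
    · have := hf t (by omega)
      rw [h, fa, ← g0] at this
      simpa [show t < a by omega, h] using this
    · have := hg (t - a) (by omega)
      simpa [show ¬ t < a by omega, show ¬ t + 1 < a by omega,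
        show t + 1 - a = t - a + 1 by omega] using this

/-- The position map `p` places the objects as prescribed by the stacks `S`, each of which is
listed from bottom to top. -/
structure Represents {n k d : ℕ} (p : Fin n → Fin k × Fin d) (S : Fin k → List (Fin n)) :
    Prop where
  mem : ∀ o, o ∈ S (p o).1
  pos_eq : ∀ i q o, (S i)[q]? = some o → (p o).1 = i ∧ ((p o).2 : ℕ) + q + 1 = d

namespace Represents

variable {n k d : ℕ} {p : Fin n → Fin k × Fin d} {S : Fin k → List (Fin n)}

theorem stack_eq (h : Represents p S) {o : Fin n} {i : Fin k} (ho : o ∈ S i) : (p o).1 = i := by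
  obtain ⟨q, hq⟩ := List.mem_iff_getElem?.1 ho
  exact (h.pos_eq i q o hq).1

theorem injective (h : Represents p S) : Function.Injective p := by
  intro a b hab
  obtain ⟨q, hq⟩ := List.mem_iff_getElem?.1 (h.mem a)
  obtain ⟨r, hr⟩ := List.mem_iff_getElem?.1 (h.mem b)
  have h₁ := (h.pos_eq _ _ _ hq).2
  have h₂ := (h.pos_eq _ _ _ hr).2
  rw [← hab] at hr h₂
  obtain rfl : q = r := by omega
  exact Option.some.inj (hq.symm.trans hr)

theorem contiguous (h : Represents p S) (o : Fin n) (j : Fin d) (hj : (p o).2 ≤ j) :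
    ∃ o', p o' = ((p o).1, j) := by
  obtain ⟨q, hq⟩ := List.mem_iff_getElem?.1 (h.mem o)
  have h₁ := (h.pos_eq _ _ _ hq).2
  have hlt := (List.getElem?_eq_some_iff.1 hq).1
  have hj' : ((p o).2 : ℕ) ≤ j := hj
  have hr : d - 1 - j < (S (p o).1).length := by omega
  obtain ⟨h₂, h₃⟩ := h.pos_eq _ _ _ (List.getElem?_eq_getElem hr)
  exact ⟨_, Prod.ext h₂ (Fin.ext (by simp only; omega))⟩

theorem exists_step {π : Arrangement n k d} (h : Represents π.pos S) {i j : Fin k} (hij : i ≠ j)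
    {t : List (Fin n)} {o : Fin n} (hi : S i = t ++ [o]) (hj : (S j).length < d) :
    ∃ π' : Arrangement n k d, Step π π' ∧
      Represents π'.pos (Function.update (Function.update S i t) j (S j ++ [o])) := by
  have ho := h.pos_eq i t.length o (by simp [hi])
  have key : Represents (Function.update π.pos o (j, ⟨d - 1 - (S j).length, by omega⟩))
      (Function.update (Function.update S i t) j (S j ++ [o])) := by
    constructor
    · intro a
      by_cases ha : a = o
      · simp [ha]
      · have hm := h.mem a
        rw [Function.update_of_ne ha]
        by_cases h₁ : (π.pos a).1 = j
        · rw [h₁] at hm ⊢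
          simp [hm]
        · rw [Function.update_of_ne h₁]
          by_cases h₂ : (π.pos a).1 = i
          · rw [h₂] at hm ⊢
            simpa [hi, ha] using hm
          · rwa [Function.update_of_ne h₂]
    · intro l q a ha
      by_cases h₁ : l = j
      · subst h₁
        rw [Function.update_self] at ha
        by_cases hq : q < (S l).length
        · rw [List.getElem?_append_left hq] at ha
          have hp := h.pos_eq _ _ _ ha
          have hne : a ≠ o := by
            rintro rfl
            exact hij (ho.1.symm.trans hp.1)
          rwa [Function.update_of_ne hne]
        · have hlt := (List.getElem?_eq_some_iff.1 ha).1
          have hq' : q = (S l).length := by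
            simp only [List.length_append, List.length_singleton] at hlt
            omega
          subst hq'
          obtain rfl : o = a := by simpa using ha
          simp only [Function.update_self, true_and]
          omega
      · rw [Function.update_of_ne h₁] at ha
        by_cases h₂ : l = i
        · subst h₂
          rw [Function.update_self] at ha
          have hlt := (List.getElem?_eq_some_iff.1 ha).1
          have hp := h.pos_eq l q a (by rwa [hi, List.getElem?_append_left hlt])
          have hne : a ≠ o := by
            rintro rfl
            omega
          rwa [Function.update_of_ne hne]
        · rw [Function.update_of_ne h₂] at ha
          have hp := h.pos_eq _ _ _ ha
          have hne : a ≠ o := by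
            rintro rfl
            exact h₂ (hp.1.symm.trans ho.1)
          rwa [Function.update_of_ne hne]
  refine ⟨⟨_, key.injective, key.contiguous⟩, ⟨o, ?_, ?_, ?_⟩, key⟩
  · simpa [ho.1] using hij.symm
  · intro a ha has
    have hm := h.mem a
    rw [has, ho.1, hi] at hm
    obtain ⟨q, hq⟩ := List.mem_iff_getElem?.1 (show a ∈ t by simpa [ha] using hm)
    have hlt := (List.getElem?_eq_some_iff.1 hq).1
    have hp := h.pos_eq i q a (by rwa [hi, List.getElem?_append_left hlt])
    exact Fin.lt_def.2 (by omega)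
  · intro a ha
    exact Function.update_of_ne ha _ _

/-- The objects `u` on top of stack `i` can be distributed over two other stacks according to any
predicate, as long as both have enough room. -/
theorem exists_reach_distribute (f : Fin n → Bool) {i j j' : Fin k} (hij : i ≠ j) (hij' : i ≠ j')
    (hjj' : j ≠ j') (t u : List (Fin n)) {S : Fin k → List (Fin n)} {π : Arrangement n k d}
    (h : Represents π.pos S) (hi : S i = t ++ u)
    (hj : (S j).length + (u.filter f).length ≤ d)
    (hj' : (S j').length + (u.filter (fun o => !f o)).length ≤ d) :
    ∃ π' : Arrangement n k d, Reach π π' u.length ∧ Represents π'.pos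
      (Function.update (Function.update (Function.update S i t) j (S j ++ u.reverse.filter f))
        j' (S j' ++ u.reverse.filter (fun o => !f o))) := by
  induction u using List.reverseRecOn generalizing S π with
  | nil =>
    refine ⟨π, Reach.refl π, ?_⟩
    convert h using 1
    funext l
    simp only [Function.update_apply]
    split_ifs with h₁ h₂ h₃ <;> simp_all
  | append_singleton u o ih =>
    rw [← List.append_assoc] at hi
    cases hf : f o with
    | true =>
      simp only [List.filter_append, List.length_append, hf, List.filter_cons, List.filter_nil,
        if_true, List.length_singleton, Bool.not_true, Bool.false_eq_true, if_false,
        List.length_nil] at hj hj'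
      obtain ⟨π₁, hs, hr⟩ := h.exists_step hij hi (by omega)
      obtain ⟨π₂, hs', hr'⟩ := ih hr (by simp [hij])
        (by simp only [Function.update_self, List.length_append, List.length_singleton]; omega)
        (by simpa [hjj'.symm, hij'.symm] using hj')
      refine ⟨π₂, by simpa [add_comm] using hs.reach.trans hs', ?_⟩
      convert hr' using 1
      funext l
      simp only [Function.update_apply]
      split_ifs <;> simp_all
    | false =>
      simp only [List.filter_append, List.length_append, hf, List.filter_cons, List.filter_nil,
        if_true, List.length_singleton, Bool.not_false, Bool.false_eq_true, if_false,
        List.length_nil] at hj hj'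
      obtain ⟨π₁, hs, hr⟩ := h.exists_step hij' hi (by omega)
      obtain ⟨π₂, hs', hr'⟩ := ih hr (by simp [hij'])
        (by simpa [hjj', hij.symm] using hj)
        (by simp only [Function.update_self, List.length_append, List.length_singleton]; omega)
      refine ⟨π₂, by simpa [add_comm] using hs.reach.trans hs', ?_⟩
      convert hr' using 1
      funext l
      simp only [Function.update_apply]
      split_ifs <;> simp_all

theorem exists_reach_move {i j j' : Fin k} (hij : i ≠ j) (hij' : i ≠ j') (hjj' : j ≠ j')
    (t u : List (Fin n)) {π : Arrangement n k d}
    (h : Represents π.pos S) (hi : S i = t ++ u) (hj : (S j).length + u.length ≤ d)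
    (hj' : (S j').length ≤ d) :
    ∃ π' : Arrangement n k d, Reach π π' u.length ∧ Represents π'.pos
      (Function.update (Function.update S i t) j (S j ++ u.reverse)) := by
  obtain ⟨π', h₁, h₂⟩ := exists_reach_distribute (fun _ => true) hij hij' hjj' t u h hi
    (by simpa using hj) (by simpa using hj')
  refine ⟨π', h₁, ?_⟩
  convert h₂ using 1
  funext l
  simp only [Function.update_apply]
  split_ifs <;> simp_all

end Represents

/-- If the first two of three stacks hold all `2 * d` objects, then they are full. -/
theorem Arrangement.exists_represents {d : ℕ} (π : Arrangement (2 * d) 3 d)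
    (hπ : ∀ o : Fin (2 * d), ((π.pos o).1 : ℕ) < 2) :
    ∃ a b : List (Fin (2 * d)), a.length = d ∧ b.length = d ∧
      Represents π.pos ![a, b, []] := by
  let g : Fin (2 * d) → Fin 2 × Fin d := fun o => (⟨(π.pos o).1, hπ o⟩, (π.pos o).2)
  have hg : Function.Injective g := by
    intro x y hxy
    simp only [g, Prod.mk.injEq, Fin.mk.injEq] at hxy
    exact π.inj (Prod.ext (Fin.ext hxy.1) hxy.2)
  obtain ⟨e, he⟩ : ∃ e : Fin (2 * d) ≃ Fin 2 × Fin d, ⇑e = g :=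
    ⟨Equiv.ofBijective g ((Fintype.bijective_iff_injective_and_card g).2 ⟨hg, by simp⟩), rfl⟩
  have hpos : ∀ i q, (((π.pos (e.symm (i, q))).1 : ℕ) = i) ∧ (π.pos (e.symm (i, q))).2 = q := by
    intro i q
    have := e.apply_symm_apply (i, q)
    rw [he] at this
    simp only [g, Prod.mk.injEq, Fin.ext_iff] at this
    exact ⟨this.1, Fin.ext this.2⟩
  have hlist : ∀ i q o, (List.ofFn fun q : Fin d => e.symm (i, q.rev))[q]? = some o →
      ((π.pos o).1 : ℕ) = i ∧ ((π.pos o).2 : ℕ) + q + 1 = d := by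
    intro i q o ho
    obtain ⟨hq, rfl⟩ := List.getElem?_eq_some_iff.1 ho
    rw [List.length_ofFn] at hq
    rw [List.getElem_ofFn, (hpos _ _).2]
    refine ⟨(hpos _ _).1, ?_⟩
    simp only [Fin.val_rev]
    omega
  have hmem : ∀ o i, ((π.pos o).1 : ℕ) = (i : Fin 2) →
      o ∈ List.ofFn fun q : Fin d => e.symm (i, q.rev) := by
    intro o i hi
    rw [List.mem_ofFn]
    refine ⟨(π.pos o).2.rev, ?_⟩
    rw [Equiv.symm_apply_eq, he]
    simp [g, hi]
  refine ⟨List.ofFn fun q => e.symm (0, q.rev), List.ofFn fun q => e.symm (1, q.rev),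
    by simp, by simp, fun o => ?_, fun i q o ho => ?_⟩
  · have hlt := hπ o
    generalize hi : (π.pos o).1 = i at hlt
    fin_cases i
    · exact hmem o 0 (by simp [hi])
    · exact hmem o 1 (by simp [hi])
    · simp at hlt
  · fin_cases i
    · exact (hlist 0 q o ho).imp_left fun h => Fin.ext h
    · exact (hlist 1 q o ho).imp_left fun h => Fin.ext h
    · simp at ho

/-- There is a universal constant `c > 0` such that for every `d ≥ 1`:
given an arrangement of `2d` objects into three stacks of capacity `d` with stacks 1 and
2 full and stack 3 empty, and a labeling of the objects of stack 1 by `L` (`true`) or `R`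
(`false`), at most `c·d` permissible pop-and-push actions lead to an arrangement in which
every object lies in its original stack (so stack 1 keeps exactly its original objects,
stack 2 keeps its original set, stack 3 is empty) and, in stack 1, all `L`-labeled
objects occupy a contiguous block of depths below all `R`-labeled objects. -/
theorem split_stack_linear :
    ∃ c : ℕ, 0 < c ∧ ∀ d : ℕ, 1 ≤ d →
      ∀ π : Arrangement (2 * d) 3 d,
        (∀ o : Fin (2 * d), ((π.pos o).1 : ℕ) < 2) →
        ∀ lab : Fin (2 * d) → Bool,
          ∃ m ≤ c * d, ∃ π' : Arrangement (2 * d) 3 d,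
            Reach π π' m ∧
            (∀ o, (π'.pos o).1 = (π.pos o).1) ∧
            (∀ o₁ o₂ : Fin (2 * d),
              ((π'.pos o₁).1 : ℕ) = 0 → ((π'.pos o₂).1 : ℕ) = 0 →
              lab o₁ = true → lab o₂ = false →
              (π'.pos o₂).2 < (π'.pos o₁).2) := by
  refine ⟨4, by norm_num, fun d _ π hπ lab => ?_⟩
  obtain ⟨a, b, ha, hb, h₀⟩ := π.exists_represents hπ
  set x := a.filter lab with hx
  set y := a.filter (fun o => !lab o) with hy
  have hxy : x.length + y.length = d := by
    exact (List.length_eq_length_filter_add lab).symm.trans ha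
  obtain ⟨b₁, b₂, rfl, hb₂⟩ : ∃ b₁ b₂, b = b₁ ++ b₂ ∧ b₂.length = x.length :=
    ⟨b.take y.length, b.drop y.length, by simp, by simp; omega⟩
  rw [List.length_append] at hb
  obtain ⟨π₁, r₁, h₁⟩ := h₀.exists_reach_move (i := 1) (j := 2) (j' := 0)
    (by decide) (by decide) (by decide) b₁ b₂ rfl (by simp; omega) (by simp [ha])
  replace h₁ : Represents π₁.pos ![a, b₁, b₂.reverse] := by
    convert h₁ using 1
    funext l
    fin_cases l <;> simp
  obtain ⟨π₂, r₂, h₂⟩ := h₁.exists_reach_distribute lab (i := 0) (j := 1) (j' := 2)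
    (by decide) (by decide) (by decide) [] a rfl
    (by change b₁.length + x.length ≤ d; omega)
    (by change b₂.reverse.length + y.length ≤ d; simp; omega)
  replace h₂ : Represents π₂.pos ![[], b₁ ++ x.reverse, b₂.reverse ++ y.reverse] := by
    convert h₂ using 1
    funext l
    fin_cases l <;> simp [hx, hy]
  obtain ⟨π₃, r₃, h₃⟩ := h₂.exists_reach_move (i := 1) (j := 0) (j' := 2)
    (by decide) (by decide) (by decide) b₁ x.reverse rfl (by simp; omega) (by simp; omega)
  replace h₃ : Represents π₃.pos ![x, b₁, b₂.reverse ++ y.reverse] := by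
    convert h₃ using 1
    funext l
    fin_cases l <;> simp
  obtain ⟨π₄, r₄, h₄⟩ := h₃.exists_reach_move (i := 2) (j := 0) (j' := 1)
    (by decide) (by decide) (by decide) b₂.reverse y.reverse rfl (by simp; omega) (by simp; omega)
  replace h₄ : Represents π₄.pos ![x ++ y, b₁, b₂.reverse] := by
    convert h₄ using 1
    funext l
    fin_cases l <;> simp
  obtain ⟨π₅, r₅, h₅⟩ := h₄.exists_reach_move (i := 2) (j := 1) (j' := 0)
    (by decide) (by decide) (by decide) [] b₂.reverse rfl (by simp; omega) (by simp; omega)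
  replace h₅ : Represents π₅.pos ![x ++ y, b₁ ++ b₂, []] := by
    convert h₅ using 1
    funext l
    fin_cases l <;> simp
  refine ⟨_, ?_, π₅, (((r₁.trans r₂).trans r₃).trans r₄).trans r₅, fun o => ?_, ?_⟩
  · simp only [List.length_reverse]
    omega
  · have hm := h₀.mem o
    apply h₅.stack_eq
    generalize (π.pos o).1 = i at hm ⊢
    fin_cases i
    · have : o ∈ a := hm
      cases hl : lab o <;> simp [hx, hy, this, hl]
    · exact hm
    · exact hm
  · intro o₁ o₂ h₁ h₂ hl₁ hl₂
    have m₁ := h₅.mem o₁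
    have m₂ := h₅.mem o₂
    rw [show (π₅.pos o₁).1 = 0 from Fin.ext h₁] at m₁
    rw [show (π₅.pos o₂).1 = 0 from Fin.ext h₂] at m₂
    have m₁' : o₁ ∈ x := by simpa [hx, hy, hl₁] using m₁
    have m₂' : o₂ ∈ y := by simpa [hx, hy, hl₂] using m₂
    obtain ⟨q, hq⟩ := List.mem_iff_getElem?.1 m₁'
    obtain ⟨r, hr⟩ := List.mem_iff_getElem?.1 m₂'
    have hlt := (List.getElem?_eq_some_iff.1 hq).1
    have e₁ := (h₅.pos_eq 0 q o₁ (by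
      change (x ++ y)[q]? = _
      rwa [List.getElem?_append_left hlt])).2
    have e₂ := (h₅.pos_eq 0 (x.length + r) o₂ (by
      change (x ++ y)[x.length + r]? = _
      rwa [List.getElem?_append_right (by omega), Nat.add_sub_cancel_left])).2
    exact Fin.lt_def.2 (by omega)
end

section
/- For every fixed integer w ≥ 2 there exists a constant c > 0 such that for every integer d ≥ 1, every LSR instance with n = wd objects in w+1 stacks of capacity d has a solution consisting of at most c · d · (1 + log d) permissible pop-and-push actions. Combined with the matching lower bound, for constant w the optimal number of actions is Θ(d log d). -/
/-- One pop-and-push action on stacks given as lists, top first. -/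
def PopPush {ι α : Type*} [DecidableEq ι] (d : ℕ) (S T : ι → List α) : Prop :=
  ∃ i j x xs, i ≠ j ∧ S i = x :: xs ∧ (S j).length < d ∧
    T = Function.update (Function.update S i xs) j (x :: S j)

/-- `Within d m S T`: the stacks `T` can be obtained from `S` by at most `m` actions. -/
inductive Within {ι α : Type*} [DecidableEq ι] (d : ℕ) :
    ℕ → (ι → List α) → (ι → List α) → Prop
  | refl (m : ℕ) (S : ι → List α) : Within d m S S
  | head {m : ℕ} {S T U : ι → List α} : PopPush d S T → Within d m T U → Within d (m + 1) S U

/-- The stacks obtained from `S` by replacing the contents of `A`, `B` and `C`. -/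
def three {ι α : Type*} [DecidableEq ι] (S : ι → List α) (A B C : ι) (a b c : List α) :
    ι → List α :=
  Function.update (Function.update (Function.update S A a) B b) C c

/-- Every object occurs exactly once. -/
def Exact {ι α : Type*} [Fintype ι] [DecidableEq α] (S : ι → List α) : Prop :=
  ∀ x, ∑ k, (S k).count x = 1

/-- Stack `C` is empty and all other stacks are full. -/
def Packed {ι α : Type*} (d : ℕ) (C : ι) (S : ι → List α) : Prop :=
  S C = [] ∧ ∀ k, k ≠ C → (S k).length = d

section Exact

variable {ι α : Type*} [Fintype ι] [DecidableEq α] {S : ι → List α}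

theorem Exact.nodup (hS : Exact S) (k : ι) : (S k).Nodup := by
  rw [List.nodup_iff_count_le_one]
  intro x
  rw [← hS x]
  exact Finset.single_le_sum (f := fun k => (S k).count x) (fun _ _ => Nat.zero_le _)
    (Finset.mem_univ k)

theorem Exact.eq_of_mem (hS : Exact S) {x : α} {i j : ι} (hi : x ∈ S i) (hj : x ∈ S j) :
    i = j := by
  classical
  by_contra hij
  have h1 : ∑ k ∈ {i, j}, (S k).count x ≤ ∑ k, (S k).count x :=
    Finset.sum_le_sum_of_subset (Finset.subset_univ _)
  rw [Finset.sum_pair hij, hS x] at h1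
  have h2 := List.count_pos_iff.2 hi
  have h3 := List.count_pos_iff.2 hj
  omega

theorem Exact.exists_mem (hS : Exact S) (x : α) : ∃ k, x ∈ S k := by
  by_contra! h
  have := hS x
  rw [Finset.sum_eq_zero fun k _ => List.count_eq_zero.2 (h k)] at this
  omega

theorem Exact.sum_length [Fintype α] (hS : Exact S) :
    ∑ k, (S k).length = Fintype.card α := by
  have h (k : ι) : (S k).length = ∑ x, (S k).count x := by
    have := Multiset.toFinset_sum_count_eq (S k : Multiset α)
    simp only [Multiset.coe_card, Multiset.coe_count] at this
    rw [← this]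
    refine Finset.sum_subset (Finset.subset_univ _) fun x _ hx => ?_
    exact List.count_eq_zero.2 (by simpa using hx)
  simp_rw [h]
  rw [Finset.sum_comm]
  simp [hS _]

theorem Exact.filter_length_add_le (hS : Exact S) {A B : ι} (hAB : A ≠ B) (g : List α) :
    ((S A).filter (· ∈ g)).length + ((S B).filter (· ∈ g)).length ≤ g.length := by
  rw [← List.length_append]
  apply List.Subperm.length_le
  apply List.Nodup.subperm
  · refine List.Nodup.append ((hS.nodup A).filter _) ((hS.nodup B).filter _) ?_
    intro x hx hy
    exact hAB (hS.eq_of_mem (List.mem_of_mem_filter hx) (List.mem_of_mem_filter hy))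
  · intro x hx
    simp only [List.mem_append, List.mem_filter, decide_eq_true_eq] at hx
    tauto

end Exact

section Stacks

variable {ι α : Type*} [DecidableEq ι] {d : ℕ}

theorem Within.mono {m m' : ℕ} {S T : ι → List α} (h : Within d m S T) (hm : m ≤ m') :
    Within d m' S T := by
  induction h generalizing m' with
  | refl m S => exact .refl _ _
  | head hs _ ih =>
    obtain ⟨k, rfl⟩ : ∃ k, m' = k + 1 := ⟨m' - 1, by omega⟩
    exact .head hs (ih (by omega))

theorem Within.trans {m m' : ℕ} {S T U : ι → List α} (h : Within d m S T)
    (h' : Within d m' T U) : Within d (m + m') S U := by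
  induction h with
  | refl m S => exact h'.mono (by omega)
  | head hs _ ih =>
    have := Within.head hs (ih h')
    exact this.mono (by omega)

theorem PopPush.length_le {S T : ι → List α} (h : PopPush d S T)
    (hS : ∀ k, (S k).length ≤ d) (k : ι) : (T k).length ≤ d := by
  obtain ⟨i, j, x, xs, hij, hi, hj, rfl⟩ := h
  by_cases hkj : k = j
  · subst hkj; simpa using hj
  · by_cases hki : k = i
    · subst hki
      have := hS k
      rw [hi] at this
      simp [hkj] at this ⊢
      omega
    · simpa [hkj, hki] using hS k

theorem PopPush.symm {S T : ι → List α} (h : PopPush d S T)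
    (hS : ∀ k, (S k).length ≤ d) : PopPush d T S := by
  obtain ⟨i, j, x, xs, hij, hi, hj, rfl⟩ := h
  refine ⟨j, i, x, S j, hij.symm, by simp, ?_, ?_⟩
  · have := hS i
    rw [hi] at this
    simp [hij] at this ⊢
    omega
  · funext k
    by_cases hki : k = i
    · subst hki; simp [hij, hi]
    · by_cases hkj : k = j
      · subst hkj; simp [hki]
      · simp [hki, hkj]

theorem Within.length_le {m : ℕ} {S T : ι → List α} (h : Within d m S T)
    (hS : ∀ k, (S k).length ≤ d) (k : ι) : (T k).length ≤ d := by
  induction h with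
  | refl m S => exact hS k
  | head hs _ ih => exact ih (hs.length_le hS)

theorem Within.symm {m : ℕ} {S T : ι → List α} (h : Within d m S T)
    (hS : ∀ k, (S k).length ≤ d) : Within d m T S := by
  induction h with
  | refl m S => exact .refl _ _
  | head hs _ ih =>
    exact (ih (hs.length_le hS)).trans (.head (hs.symm hS) (.refl 0 _))

theorem PopPush.exact [Fintype ι] [DecidableEq α] {S T : ι → List α} (h : PopPush d S T)
    (hS : Exact S) : Exact T := by
  obtain ⟨i, j, x, xs, hij, hi, hj, rfl⟩ := h
  intro y
  have key : ∑ k, ((Function.update (Function.update S i xs) j (x :: S j) k).count y +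
      if k = i then (if x = y then 1 else 0) else 0) =
      ∑ k, ((S k).count y + if k = j then (if x = y then 1 else 0) else 0) := by
    refine Finset.sum_congr rfl fun k _ => ?_
    by_cases hkj : k = j
    · subst hkj
      simp [hij.symm, List.count_cons]
    · by_cases hki : k = i
      · subst hki
        simp [hkj, hi, List.count_cons]
      · simp [hkj, hki]
  simp only [Finset.sum_add_distrib, Finset.sum_ite_eq', Finset.mem_univ, if_true] at key
  have := hS y
  omega

theorem Within.exact [Fintype ι] [DecidableEq α] {m : ℕ} {S T : ι → List α}
    (h : Within d m S T) (hS : Exact S) : Exact T := by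
  induction h with
  | refl m S => exact hS
  | head hs _ ih => exact ih (hs.exact hS)

theorem within_move {S : ι → List α} {i j : ι} (hij : i ≠ j) (l r : List α)
    (hi : S i = l ++ r) (hj : (S j).length + l.length ≤ d) :
    Within d l.length S
      (Function.update (Function.update S i r) j (l.reverse ++ S j)) := by
  induction l generalizing S with
  | nil =>
    have : Function.update (Function.update S i r) j (([] : List α).reverse ++ S j) = S := by
      funext k
      by_cases hkj : k = j
      · subst hkj; simp
      · by_cases hki : k = i
        · subst hki; simpa [hkj] using hi.symm
        · simp [hkj, hki]
    rw [this]
    exact .refl _ _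
  | cons x l ih =>
    simp only [List.length_cons] at hj
    refine .head ⟨i, j, x, l ++ r, hij, by simpa using hi, by omega, rfl⟩ ?_
    have := ih (S := Function.update (Function.update S i (l ++ r)) j (x :: S j))
      (by simp [hij]) (by simp; omega)
    convert this using 1
    funext k
    by_cases hkj : k = j
    · subst hkj; simp
    · by_cases hki : k = i
      · subst hki; simp [hkj]
      · simp [hkj, hki]

theorem three_self (S : ι → List α) (A B C : ι) :
    three S A B C (S A) (S B) (S C) = S := by
  funext k
  simp only [three, Function.update_apply]
  split_ifs <;> simp_all

theorem three_swap_left (S : ι → List α) {A B C : ι} (h : A ≠ B) (a b c : List α) :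
    three S A B C a b c = three S B A C b a c := by
  simp [three, Function.update_comm h]

theorem three_swap_right (S : ι → List α) {A B C : ι} (h : B ≠ C) (a b c : List α) :
    three S A B C a b c = three S A C B a c b := by
  simp [three, Function.update_comm h]

variable {A B C : ι}

theorem update_update_eq_three (S : ι → List α) (hBC : B ≠ C) (hAC : A ≠ C) (hC : S C = [])
    (a b : List α) :
    Function.update (Function.update S A a) B b = three S A B C a b [] := by
  refine (Function.update_eq_self_iff.2 ?_).symm
  simp [hBC.symm, hAC.symm, hC]

theorem three_move (S : ι → List α) (hAB : A ≠ B) (hBC : B ≠ C) (hAC : A ≠ C)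
    (l r b c : List α) (h : b.length + l.length ≤ d) :
    Within d l.length (three S A B C (l ++ r) b c)
      (three S A B C r (l.reverse ++ b) c) := by
  have := within_move (d := d) (S := three S A B C (l ++ r) b c) hAB l r
    (by simp [three, hAB, hAC]) (by simpa [three, hBC] using h)
  convert this using 1
  funext k
  simp only [three, Function.update_apply]
  split_ifs <;> simp_all

theorem three_distribute (S : ι → List α) (hAB : A ≠ B) (hBC : B ≠ C) (hAC : A ≠ C)
    (p : α → Bool) (l b c : List α)
    (hb : b.length + (l.filter p).length ≤ d)
    (hc : c.length + (l.filter fun x => !p x).length ≤ d) :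
    Within d l.length (three S A B C l b c)
      (three S A B C [] ((l.filter p).reverse ++ b)
        ((l.filter fun x => !p x).reverse ++ c)) := by
  induction l generalizing b c with
  | nil => exact .refl _ _
  | cons x l ih =>
    rw [List.length_cons, Nat.add_comm]
    by_cases hx : p x = true
    · simp only [List.filter_cons, hx, Bool.not_true, if_true, List.length_cons] at hb hc ⊢
      refine (three_move S hAB hBC hAC [x] l b c (by simp; omega)).trans ?_
      simpa using ih (x :: b) c (by simp; omega) (by simpa using hc)
    · simp only [List.filter_cons, hx, Bool.not_false, if_true, List.length_cons] at hb hc ⊢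
      have h1 := three_move (d := d) S hAC hBC.symm hAB [x] l c b (by simp; omega)
      rw [three_swap_right S hBC.symm, three_swap_right S hBC.symm] at h1
      refine h1.trans ?_
      simpa using ih b (x :: c) (by simpa using hb) (by simp; omega)

theorem within_stablePartition (S : ι → List α) (hAB : A ≠ B) (hBC : B ≠ C) (hAC : A ≠ C)
    (p : α → Bool) (hA : (S A).length ≤ d) (hB : (S B).length = d) (hC : S C = []) :
    Within d (4 * d) S (Function.update S A
      ((S A).filter p ++ (S A).filter fun x => !p x)) := by
  set l := S A with hl
  set u := l.filter p with hu
  set v := l.filter fun x => !p x with hv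
  have huv : u.length + v.length = l.length := by
    rw [hu, hv]; exact List.length_eq_length_filter_add p |>.symm
  set b₁ := (S B).take u.length with hb₁
  set b₂ := (S B).drop u.length with hb₂
  have hb : S B = b₁ ++ b₂ := (List.take_append_drop _ _).symm
  have l₁ : b₁.length = u.length := by simp [hb₁]; omega
  have l₂ : b₂.length = d - u.length := by simp [hb₂, hB]
  have e : S = three S A B C l (b₁ ++ b₂) [] := by
    rw [← hb, ← hC, hl, three_self]
  have e' : Function.update S A (u ++ v) = three S A B C (u ++ v) (b₁ ++ b₂) [] := by
    rw [← hb, ← hC]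
    funext k
    by_cases hkA : k = A
    · simp [three, hkA, hAB, hAC]
    · simp only [three, Function.update_apply, if_neg hkA]
      split_ifs with h1 h2
      · rw [h1]
      · rw [h2]
      · rfl
  have s₁ : Within d u.length S (three S A B C l b₂ b₁.reverse) := by
    have := three_move (d := d) S hBC hAC.symm hAB.symm b₁ b₂ [] l (by simp; omega)
    rw [three_swap_right S hAC.symm, three_swap_left S hAB.symm,
      three_swap_right S hAC.symm (a := b₂), three_swap_left S hAB.symm (a := b₂), ← e] at this
    simpa [l₁] using this
  have s₂ : Within d l.length (three S A B C l b₂ b₁.reverse)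
      (three S A B C [] (u.reverse ++ b₂) (v.reverse ++ b₁.reverse)) :=
    three_distribute S hAB hBC hAC p l b₂ b₁.reverse (by rw [← hu]; omega)
      (by rw [← hv]; simp; omega)
  have s₃ : Within d v.length
      (three S A B C [] (u.reverse ++ b₂) (v.reverse ++ b₁.reverse))
      (three S A B C v (u.reverse ++ b₂) b₁.reverse) := by
    have := three_move (d := d) S hAC.symm hAB hBC.symm v.reverse b₁.reverse [] (u.reverse ++ b₂)
      (by simp; omega)
    rw [three_swap_left S hAC.symm, three_swap_right S hBC.symm,
      three_swap_left S hAC.symm (a := b₁.reverse), three_swap_right S hBC.symm] at this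
    simpa using this
  have s₄ : Within d u.length (three S A B C v (u.reverse ++ b₂) b₁.reverse)
      (three S A B C (u ++ v) b₂ b₁.reverse) := by
    have := three_move (d := d) S hAB.symm hAC hBC u.reverse b₂ v b₁.reverse (by simp; omega)
    rw [three_swap_left S hAB.symm, three_swap_left S hAB.symm (a := b₂)] at this
    simpa using this
  have s₅ : Within d u.length (three S A B C (u ++ v) b₂ b₁.reverse)
      (three S A B C (u ++ v) (b₁ ++ b₂) []) := by
    have := three_move (d := d) S hBC.symm hAB.symm hAC.symm b₁.reverse [] b₂ (u ++ v)
      (by simp; omega)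
    rw [three_swap_right S hAB.symm, three_swap_left S hAC.symm, three_swap_right S hBC.symm,
      three_swap_right S hAB.symm, three_swap_left S hAC.symm (a := []),
      three_swap_right S hBC.symm] at this
    simpa [l₁] using this
  rw [e']
  exact ((((s₁.trans s₂).trans s₃).trans s₄).trans s₅).mono (by omega)

theorem pairwise_mod_two_pow_succ (key : α → ℕ) (t : ℕ) (l : List α)
    (h : l.Pairwise fun x y => key x % 2 ^ t ≤ key y % 2 ^ t) :
    (l.filter (fun x => !(key x).testBit t) ++
      l.filter fun x => !!(key x).testBit t).Pairwise
        fun x y => key x % 2 ^ (t + 1) ≤ key y % 2 ^ (t + 1) := by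
  have hm (x : α) : key x % 2 ^ (t + 1) =
      key x % 2 ^ t + if (key x).testBit t then 2 ^ t else 0 := by
    rw [Nat.mod_pow_succ, ← Nat.toNat_testBit]
    cases (key x).testBit t <;> simp
  rw [List.pairwise_append]
  refine ⟨?_, ?_, ?_⟩
  · rw [List.pairwise_filter]
    refine h.imp fun {x y} hxy hx hy => ?_
    simp_all
  · rw [List.pairwise_filter]
    refine h.imp fun {x y} hxy hx hy => ?_
    simp_all
  · intro x hx y hy
    simp only [List.mem_filter, Bool.not_eq_true', Bool.not_not] at hx hy
    rw [hm x, hm y]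
    have := Nat.mod_lt (key x) (Nat.two_pow_pos t)
    simp [hx.2, hy.2]
    omega

theorem exists_within_pairwise_mod (S : ι → List α) (hAB : A ≠ B) (hBC : B ≠ C) (hAC : A ≠ C)
    (hA : (S A).length ≤ d) (hB : (S B).length = d) (hC : S C = []) (key : α → ℕ) (t : ℕ) :
    ∃ l, l.Perm (S A) ∧ (l.Pairwise fun x y => key x % 2 ^ t ≤ key y % 2 ^ t) ∧
      Within d (t * (4 * d)) S (Function.update S A l) := by
  induction t with
  | zero =>
    refine ⟨S A, .refl _, ?_, by simpa using .refl _ _⟩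
    simp [Nat.mod_one, List.pairwise_of_forall]
  | succ t ih =>
    obtain ⟨l, hl, hp, hw⟩ := ih
    refine ⟨_, ?_, pairwise_mod_two_pow_succ key t l hp, ?_⟩
    · exact (List.filter_append_perm _ l).trans hl
    · have := within_stablePartition (d := d) (Function.update S A l) hAB hBC hAC
        (fun x => !(key x).testBit t) (by simpa [hl.length_eq] using hA)
        (by simpa [hAB.symm] using hB) (by simpa [hAC.symm] using hC)
      rw [Function.update_self, Function.update_idem] at this
      exact (hw.trans this).mono (le_of_eq (Nat.succ_mul _ _).symm)

theorem within_sort [DecidableEq α] (S : ι → List α) (hAB : A ≠ B) (hBC : B ≠ C) (hAC : A ≠ C)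
    (hA : (S A).length ≤ d) (hB : (S B).length = d) (hC : S C = [])
    {l : List α} (hl : l.Perm (S A)) (hn : l.Nodup) {t : ℕ} (ht : d ≤ 2 ^ t) :
    Within d (t * (4 * d)) S (Function.update S A l) := by
  obtain ⟨l', hl', hp, hw⟩ := exists_within_pairwise_mod S hAB hBC hAC hA hB hC
    (fun x => l.idxOf x) t
  have hll : l'.Perm l := hl'.trans hl.symm
  have hmod {x : α} (hx : x ∈ l) : l.idxOf x % 2 ^ t = l.idxOf x := by
    apply Nat.mod_eq_of_lt
    have := List.idxOf_lt_length_of_mem hx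
    rw [hl.length_eq] at this
    omega
  have hp' : l.Pairwise fun x y => l.idxOf x % 2 ^ t ≤ l.idxOf y % 2 ^ t := by
    rw [List.pairwise_iff_getElem]
    intro i j hi hj hij
    rw [hmod (List.getElem_mem _), hmod (List.getElem_mem _), hn.idxOf_getElem, hn.idxOf_getElem]
    omega
  have : l' = l := by
    refine List.Perm.eq_of_pairwise ?_ hp hp' hll
    intro x y hx hy h1 h2
    rw [hmod (hll.subset hx), hmod hy] at h1 h2
    exact (List.idxOf_inj (hll.subset hx)).1 (le_antisymm h1 h2)
  exact this ▸ hw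

theorem within_exchange (S : ι → List α) (hAB : A ≠ B) (hBC : B ≠ C) (hAC : A ≠ C)
    (hA : (S A).length = d) (hB : (S B).length = d) (hC : S C = []) (p : α → Bool)
    (hp : ((S A).filter p).length + ((S B).filter p).length ≤ d) :
    ∃ a b, a.length = d ∧ b.length = d ∧ (∀ x ∈ b, p x = false) ∧
      Within d (11 * d) S (Function.update (Function.update S A a) B b) := by
  set u := (S A).filter fun x => !p x with hu
  set v := (S A).filter fun x => !!p x with hv
  set f := (S B).filter p with hf
  set g := (S B).filter fun x => !p x with hg
  have huv : u.length + v.length = d := by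
    rw [← hA, hu, hv]; exact (List.length_eq_length_filter_add fun x => !p x).symm
  have hfg : f.length + g.length = d := by
    rw [← hB, hf, hg]; exact (List.length_eq_length_filter_add p).symm
  have hv' : ((S A).filter p).length = v.length := by simp [hv]
  set u₁ := u.take f.length with hu₁
  set u₂ := u.drop f.length with hu₂
  have hu₁₂ : u = u₁ ++ u₂ := (List.take_append_drop _ _).symm
  have l₁ : u₁.length = f.length := by simp [hu₁]; omega
  have l₂ : u₂.length = u.length - f.length := by simp [hu₂]
  have s₁ := within_stablePartition S hAB hBC hAC (fun x => !p x) hA.le hB hC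
  have s₂ := within_stablePartition (d := d) (Function.update S A (u ++ v)) hAB.symm hAC hBC p
    (by simpa [hAB.symm] using hB.le) (by simp; omega) (by simpa [hAC.symm] using hC)
  rw [Function.update_of_ne hAB.symm, ← hf, ← hg] at s₂
  have e : Function.update (Function.update S A (u ++ v)) B (f ++ g) =
      three S A B C (u₁ ++ (u₂ ++ v)) (f ++ g) [] := by
    rw [update_update_eq_three S hBC hAC hC, hu₁₂, List.append_assoc]
  have s₃ : Within d f.length (three S A B C (u₁ ++ (u₂ ++ v)) (f ++ g) [])
      (three S A B C (u₂ ++ v) (f ++ g) u₁.reverse) := by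
    have := three_move (d := d) S hAC hBC.symm hAB u₁ (u₂ ++ v) [] (f ++ g) (by simp; omega)
    rw [three_swap_right S hBC.symm, three_swap_right S hBC.symm (b := _ ++ [])] at this
    simpa [l₁] using this
  have s₄ : Within d f.length (three S A B C (u₂ ++ v) (f ++ g) u₁.reverse)
      (three S A B C (f.reverse ++ (u₂ ++ v)) g u₁.reverse) := by
    have := three_move (d := d) S hAB.symm hAC hBC f g (u₂ ++ v) u₁.reverse (by simp; omega)
    rwa [three_swap_left S hAB.symm, three_swap_left S hAB.symm (a := g)] at this
  have s₅ : Within d f.length (three S A B C (f.reverse ++ (u₂ ++ v)) g u₁.reverse)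
      (three S A B C (f.reverse ++ (u₂ ++ v)) (u₁ ++ g) []) := by
    have := three_move (d := d) S hBC.symm hAB.symm hAC.symm u₁.reverse [] g
      (f.reverse ++ (u₂ ++ v)) (by simp; omega)
    rw [three_swap_right S hAB.symm, three_swap_left S hAC.symm, three_swap_right S hBC.symm,
      three_swap_right S hAB.symm, three_swap_left S hAC.symm (a := []),
      three_swap_right S hBC.symm] at this
    simpa [l₁] using this
  refine ⟨f.reverse ++ (u₂ ++ v), u₁ ++ g, by simp; omega, by simp; omega, ?_, ?_⟩
  · intro x hx
    have hx' : x ∈ u ∨ x ∈ g := by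
      rw [hu₁₂]
      simp only [List.mem_append] at hx ⊢
      tauto
    rcases hx' with h | h
    · simpa using (List.mem_filter.1 h).2
    · simpa using (List.mem_filter.1 h).2
  · rw [update_update_eq_three S hBC hAC hC]
    rw [e] at s₂
    exact ((((s₁.trans s₂).trans s₃).trans s₄).trans s₅).mono (by omega)

variable [Fintype ι] [DecidableEq α]

theorem exists_within_collect (hAC : A ≠ C) (g : List α) (hg : g.length = d) (m : ℕ)
    (S : ι → List α) (hS : Exact S) (hP : Packed d C S)
    (hm : (Finset.univ.filter fun k => k ≠ A ∧ ∃ x ∈ S k, x ∈ g).card ≤ m) :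
    ∃ T, Within d (m * (11 * d)) S T ∧ Packed d C T ∧
      (∀ k, k ≠ A → (∀ x ∈ S k, x ∉ g) → T k = S k) ∧
      ∀ k, k ≠ A → ∀ x ∈ T k, x ∉ g := by
  induction m generalizing S with
  | zero =>
    refine ⟨S, .refl _ _, hP, fun _ _ _ => rfl, fun k hk x hx hxg => ?_⟩
    have := Finset.card_eq_zero.1 (Nat.le_zero.1 hm)
    exact Finset.eq_empty_iff_forall_notMem.1 this k (by simpa using ⟨hk, x, hx, hxg⟩)
  | succ m ih =>
    by_cases h : ∃ B, B ≠ A ∧ ∃ x ∈ S B, x ∈ g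
    · obtain ⟨B, hBA, x, hx, hxg⟩ := h
      have hBC : B ≠ C := by
        rintro rfl
        simp [hP.1] at hx
      obtain ⟨a, b, ha, hb, hbg, hw⟩ := within_exchange S hBA.symm hBC hAC (hP.2 A hAC)
        (hP.2 B hBC) hP.1 (fun x => decide (x ∈ g))
        (hg ▸ hS.filter_length_add_le hBA.symm g)
      set S' := Function.update (Function.update S A a) B b with hS'
      have hB' : S' B = b := by simp [hS']
      have hk' (k : ι) (hkA : k ≠ A) (hkB : k ≠ B) : S' k = S k := by simp [hS', hkA, hkB]
      have hP' : Packed d C S' := by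
        refine ⟨by rw [hk' C hAC.symm hBC.symm, hP.1], fun k hk => ?_⟩
        by_cases hkB : k = B
        · rw [hkB, hB', hb]
        · by_cases hkA : k = A
          · subst hkA; simpa [hS', hkB] using ha
          · rw [hk' k hkA hkB, hP.2 k hk]
      have hcard : (Finset.univ.filter fun k => k ≠ A ∧ ∃ x ∈ S' k, x ∈ g).card ≤ m := by
        refine Nat.le_of_lt_succ (lt_of_lt_of_le (Finset.card_lt_card ?_) hm)
        rw [Finset.ssubset_iff_of_subset]
        · refine ⟨B, by simpa using ⟨hBA, x, hx, hxg⟩, ?_⟩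
          simpa [hB', hBA] using hbg
        · intro k hk
          simp only [Finset.mem_filter, Finset.mem_univ, true_and] at hk ⊢
          obtain ⟨hkA, y, hy, hyg⟩ := hk
          have hkB : k ≠ B := by
            rintro rfl
            simpa [hyg] using hbg y (hB' ▸ hy)
          exact ⟨hkA, y, hk' k hkA hkB ▸ hy, hyg⟩
      obtain ⟨T, hT, hTP, hTk, hTg⟩ := ih S' (hw.exact hS) hP' hcard
      refine ⟨T, (hw.trans hT).mono (le_of_eq (by ring)), hTP, fun k hk hkg => ?_, hTg⟩
      have hkB : k ≠ B := by
        rintro rfl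
        exact hkg x hx hxg
      rw [hTk k hk (by rwa [hk' k hk hkB]), hk' k hk hkB]
    · push Not at h
      exact ⟨S, .refl _ _, hP, fun _ _ _ => rfl, h⟩

theorem within_of_packed (hcard : 3 ≤ Fintype.card ι) {t : ℕ} (ht : d ≤ 2 ^ t)
    {G : ι → List α} (hG : Exact G) (hGP : Packed d C G) (m : ℕ)
    (S : ι → List α) (hS : Exact S) (hP : Packed d C S)
    (hm : (Finset.univ.filter fun k => S k ≠ G k).card ≤ m) :
    Within d (m * (Fintype.card ι * (11 * d) + t * (4 * d))) S G := by
  induction m generalizing S with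
  | zero =>
    have h0 := Finset.card_eq_zero.1 (Nat.le_zero.1 hm)
    have : S = G := by
      funext k
      by_contra hk
      exact Finset.eq_empty_iff_forall_notMem.1 h0 k (by simpa using hk)
    exact this ▸ .refl _ _
  | succ m ih =>
    by_cases h : ∃ A, S A ≠ G A
    · obtain ⟨A, hA⟩ := h
      have hAC : A ≠ C := by
        rintro rfl
        exact hA (hP.1.trans hGP.1.symm)
      obtain ⟨T, hw, hTP, hTk, hTg⟩ := exists_within_collect hAC (G A) (hGP.2 A hAC)
        (Fintype.card ι) S hS hP (Finset.card_le_univ _)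
      have hT := hw.exact hS
      have hperm : (G A).Perm (T A) := by
        refine ((hG.nodup A).subperm fun x hx => ?_).perm_of_length_le ?_
        · obtain ⟨k, hk⟩ := hT.exists_mem x
          by_cases hkA : k = A
          · exact hkA ▸ hk
          · exact absurd hx (hTg k hkA x hk)
        · rw [hTP.2 A hAC, hGP.2 A hAC]
      obtain ⟨B, hB⟩ : ∃ B, B ∉ ({A, C} : Finset ι) := by
        by_contra! hall
        have h2 : Finset.univ ⊆ ({A, C} : Finset ι) := fun x _ => hall x
        have h3 := Finset.card_le_card h2
        rw [Finset.card_univ] at h3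
        have := Finset.card_le_two (a := A) (b := C)
        omega
      simp only [Finset.mem_insert, Finset.mem_singleton, not_or] at hB
      have hs := within_sort T (Ne.symm hB.1) hB.2 hAC (hTP.2 A hAC).le (hTP.2 B hB.2) hTP.1
        hperm (hG.nodup A) ht
      have hw' := hw.trans hs
      refine (hw'.trans (ih _ (hw'.exact hS) ?_ ?_)).mono (le_of_eq (by ring))
      · refine ⟨by simpa [hAC.symm] using hTP.1, fun k hk => ?_⟩
        by_cases hkA : k = A
        · subst hkA; simpa using hGP.2 k hk
        · simpa [hkA] using hTP.2 k hk
      · refine Nat.le_of_lt_succ (lt_of_lt_of_le (Finset.card_lt_card ?_) hm)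
        rw [Finset.ssubset_iff_of_subset]
        · exact ⟨A, by simpa using hA, by simp⟩
        · intro k hk
          simp only [Finset.mem_filter, Finset.mem_univ, true_and] at hk ⊢
          have hkA : k ≠ A := by
            rintro rfl
            simp at hk
          rw [Function.update_of_ne hkA] at hk
          intro hSG
          apply hk
          rw [hTk k hkA fun x hx hxA => hkA (hG.eq_of_mem (hSG ▸ hx) hxA), hSG]
    · push Not at h
      exact (funext h : S = G) ▸ .refl _ _

theorem exists_within_packed [Fintype α] (hα : Fintype.card α + d = Fintype.card ι * d) (C : ι)
    (m : ℕ) (S : ι → List α) (hS : Exact S) (hd : ∀ k, (S k).length ≤ d)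
    (hm : (S C).length = m) : ∃ T, Within d m S T ∧ Packed d C T := by
  have hsum (P : ι → ℕ) : ∑ k, P k = P C + ∑ k ∈ Finset.univ.erase C, P k :=
    (Finset.add_sum_erase _ _ (Finset.mem_univ C)).symm
  have hconst : Fintype.card ι * d = d + ∑ k ∈ Finset.univ.erase C, d := by
    rw [← hsum fun _ => d]; simp
  induction m generalizing S with
  | zero =>
    refine ⟨S, .refl _ _, List.length_eq_zero_iff.1 hm, ?_⟩
    have h1 := hsum fun k => (S k).length
    rw [hS.sum_length, hm] at h1
    have h2 : ∑ k ∈ Finset.univ.erase C, (S k).length = ∑ k ∈ Finset.univ.erase C, d := by omega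
    intro k hk
    exact (Finset.sum_eq_sum_iff_of_le fun k _ => hd k).1 h2 k (by simpa using hk)
  | succ m ih =>
    obtain ⟨x, xs, hx⟩ := List.exists_cons_of_length_eq_add_one hm
    obtain ⟨B, hBC, hB⟩ : ∃ B, B ≠ C ∧ (S B).length < d := by
      by_contra! h
      have h1 := hsum fun k => (S k).length
      rw [hS.sum_length, hm] at h1
      have h2 : ∑ k ∈ Finset.univ.erase C, d ≤ ∑ k ∈ Finset.univ.erase C, (S k).length :=
        Finset.sum_le_sum fun k hk => h k (Finset.ne_of_mem_erase hk)
      omega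
    have hs : PopPush d S _ := ⟨C, B, x, xs, hBC.symm, hx, hB, rfl⟩
    obtain ⟨T, hT, hTP⟩ := ih _ (hs.exact hS) (hs.length_le hd) (by
      rw [hx] at hm
      simpa [hBC.symm] using hm)
    exact ⟨T, .head hs hT, hTP⟩

theorem within_of_exact [Fintype α] (hcard : 3 ≤ Fintype.card ι)
    (hα : Fintype.card α + d = Fintype.card ι * d) {t : ℕ} (ht : d ≤ 2 ^ t)
    {S G : ι → List α} (hS : Exact S) (hG : Exact G)
    (hSd : ∀ k, (S k).length ≤ d) (hGd : ∀ k, (G k).length ≤ d) :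
    Within d (d + Fintype.card ι * (Fintype.card ι * (11 * d) + t * (4 * d)) + d) S G := by
  obtain ⟨C⟩ : Nonempty ι := Fintype.card_pos_iff.1 (by omega)
  obtain ⟨S', hS', hSP⟩ := exists_within_packed hα C _ S hS hSd rfl
  obtain ⟨G', hG', hGP⟩ := exists_within_packed hα C _ G hG hGd rfl
  have h := within_of_packed hcard ht (hG'.exact hG) hGP (Fintype.card ι) S' (hS'.exact hS) hSP
    (Finset.card_le_univ _)
  exact ((hS'.mono (hSd C)).trans h).trans ((hG'.symm hGd).mono (hGd C))

end Stacks

/-- The lists `S` (top first) describe the arrangement `π`. -/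
def Represents_s14 {n k d : ℕ} (π : Arrangement n k d) (S : Fin k → List (Fin n)) : Prop :=
  ∀ o i (j : Fin d), π.pos o = (i, j) ↔ ∃ a b, S i = a ++ o :: b ∧ b.length + j + 1 = d

section Represents_s14

variable {n k d : ℕ}

theorem Arrangement.ext_pos {π π' : Arrangement n k d} (h : ∀ o, π.pos o = π'.pos o) :
    π = π' := by
  have : π.pos = π'.pos := funext h
  cases π; cases π'; congr

theorem Represents_s14.unique {π π' : Arrangement n k d} {S : Fin k → List (Fin n)}
    (h : Represents_s14 π S) (h' : Represents_s14 π' S) : π = π' :=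
  Arrangement.ext_pos fun o => ((h' o _ _).2 ((h o _ _).1 rfl)).symm

theorem exists_arrangement {S : Fin k → List (Fin n)} (hS : Exact S)
    (hd : ∀ i, (S i).length ≤ d) : ∃ π : Arrangement n k d, Represents_s14 π S := by
  have hex (o : Fin n) : ∃ (p : Fin k × Fin d) (a b : List (Fin n)),
      S p.1 = a ++ o :: b ∧ b.length + p.2 + 1 = d := by
    obtain ⟨i, hi⟩ := hS.exists_mem o
    obtain ⟨a, b, hab⟩ := List.append_of_mem hi
    have := hd i
    rw [hab] at this
    simp only [List.length_append, List.length_cons] at this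
    exact ⟨(i, ⟨d - 1 - b.length, by omega⟩), a, b, hab, by simp; omega⟩
  choose pos hpos using hex
  have hrep (o : Fin n) (i : Fin k) (j : Fin d) :
      pos o = (i, j) ↔ ∃ a b, S i = a ++ o :: b ∧ b.length + j + 1 = d := by
    constructor
    · intro h
      simpa only [h] using hpos o
    · rintro ⟨a, b, hab, hb⟩
      obtain ⟨a', b', hab', hb'⟩ := hpos o
      have hi : (pos o).1 = i :=
        hS.eq_of_mem (x := o) (by rw [hab']; simp) (by rw [hab]; simp)
      have hn := hS.nodup i
      rw [hi, hab] at hab'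
      rw [hab] at hn
      have hoa : o ∉ a := fun h => (List.nodup_append.1 hn).2.2 o h o (by simp) rfl
      rw [hab'] at hn
      have hoa' : o ∉ a' := fun h => (List.nodup_append.1 hn).2.2 o h o (by simp) rfl
      have hbb : b = b' := by
        have hla : a.length = a'.length := by
          simpa [List.idxOf_append, hoa, hoa'] using congrArg (List.idxOf o) hab'
        exact (List.cons.inj (List.append_inj hab' hla).2).2
      subst hbb
      exact Prod.ext hi (Fin.ext (by simp only; omega))
  refine ⟨⟨pos, ?_, ?_⟩, hrep⟩
  · intro o o' h
    obtain ⟨a, b, hab, hb⟩ := hpos o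
    obtain ⟨a', b', hab', hb'⟩ := hpos o'
    rw [h, hab'] at hab
    rw [h] at hb
    have := (List.append_inj' hab (by simp; omega)).2
    simp at this
    exact this.1.symm
  · intro o j hj
    obtain ⟨a, b, hab, hb⟩ := hpos o
    have hj' : ((pos o).2 : ℕ) ≤ j := hj
    have hjd := j.2
    set l := S (pos o).1 with hl
    have hlen : l.length = a.length + b.length + 1 := by rw [hab]; simp; omega
    have hlt : l.length + j - d < l.length := by omega
    refine ⟨l[l.length + j - d], (hrep _ _ _).2
      ⟨l.take (l.length + j - d), l.drop (l.length + j - d + 1), ?_, ?_⟩⟩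
    · simp [hl]
    · simp; omega

theorem exists_represents (π : Arrangement n k d) :
    ∃ S : Fin k → List (Fin n), Represents_s14 π S ∧ ∀ i, (S i).length ≤ d := by
  have key (i : Fin k) (m : ℕ) (hm : m ≤ d) : ∃ l : List (Fin n), l.length ≤ m ∧
      ∀ o (j : Fin d), (π.pos o = (i, j) ∧ d ≤ j + m) ↔
        ∃ a b, l = a ++ o :: b ∧ b.length + j + 1 = d := by
    induction m with
    | zero =>
      refine ⟨[], le_rfl, fun o j => ⟨fun h => ?_, ?_⟩⟩
      · have := j.2
        omega
      · rintro ⟨a, b, h, -⟩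
        simp at h
    | succ m ih =>
      obtain ⟨l, hlm, hl⟩ := ih (by omega)
      have hlt : d - (m + 1) < d := by omega
      by_cases ho : ∃ o, π.pos o = (i, ⟨d - (m + 1), hlt⟩)
      · obtain ⟨o, ho⟩ := ho
        have hlen : l.length = m := by
          refine le_antisymm hlm ?_
          rcases Nat.eq_zero_or_pos m with rfl | hm0
          · exact Nat.zero_le _
          · obtain ⟨o', ho'⟩ := π.contig o ⟨d - m, by omega⟩ (by
              rw [ho, Fin.mk_le_mk]; omega)
            rw [ho] at ho'
            obtain ⟨a, b, rfl, hb⟩ := (hl o' _).1 ⟨ho', by simp; omega⟩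
            simp at hb ⊢
            omega
        refine ⟨o :: l, by simp; omega, fun o' j => ⟨fun ⟨h1, h2⟩ => ?_, ?_⟩⟩
        · by_cases hj : d ≤ j + m
          · obtain ⟨a, b, rfl, hb⟩ := (hl o' j).1 ⟨h1, hj⟩
            exact ⟨o :: a, b, rfl, hb⟩
          · have hjj : j = ⟨d - (m + 1), hlt⟩ := Fin.ext (by simp; omega)
            have : o' = o := π.inj (by rw [h1, ho, hjj])
            subst this
            exact ⟨[], l, rfl, by omega⟩
        · rintro ⟨a, b, hab, hb⟩
          cases a with
          | nil =>
            simp only [List.nil_append, List.cons.injEq] at hab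
            obtain ⟨rfl, rfl⟩ := hab
            refine ⟨?_, by omega⟩
            rw [ho]
            exact Prod.ext rfl (Fin.ext (by simp; omega))
          | cons y a =>
            simp only [List.cons_append, List.cons.injEq] at hab
            have := (hl o' j).2 ⟨a, b, hab.2, hb⟩
            exact ⟨this.1, by omega⟩
      · refine ⟨l, by omega, fun o' j => ?_⟩
        rw [← hl o' j]
        refine ⟨fun ⟨h1, h2⟩ => ⟨h1, ?_⟩, fun ⟨h1, h2⟩ => ⟨h1, by omega⟩⟩
        by_contra hj
        have hjj : j = ⟨d - (m + 1), hlt⟩ := Fin.ext (by simp; omega)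
        exact ho ⟨o', hjj ▸ h1⟩
  choose S hS using fun i => key i d le_rfl
  refine ⟨S, fun o i j => ?_, fun i => (hS i).1⟩
  rw [← (hS i).2 o j]
  simp

theorem Represents_s14.exact {π : Arrangement n k d} {S : Fin k → List (Fin n)}
    (h : Represents_s14 π S) (hd : ∀ i, (S i).length ≤ d) : Exact S := by
  have hpos {o : Fin n} {i : Fin k} {a b : List (Fin n)} (hab : S i = a ++ o :: b) :
      (π.pos o).1 = i ∧ b.length + (π.pos o).2 + 1 = d := by
    have hl := hd i
    rw [hab] at hl
    simp only [List.length_append, List.length_cons] at hl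
    rw [(h o i ⟨d - 1 - b.length, by omega⟩).2 ⟨a, b, hab, by simp; omega⟩]
    exact ⟨rfl, by simp; omega⟩
  intro o
  obtain ⟨a, b, hab, hb⟩ := (h o (π.pos o).1 (π.pos o).2).1 rfl
  rw [Finset.sum_eq_single (π.pos o).1]
  · refine List.count_eq_one_of_mem ?_ (by rw [hab]; simp)
    rw [List.nodup_iff_injective_get]
    intro p q hpq
    have hdec (r : Fin (S (π.pos o).1).length) : S (π.pos o).1 =
        (S (π.pos o).1).take r ++ (S (π.pos o).1).get r :: (S (π.pos o).1).drop (r + 1) := by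
      simp
    have hp := (hpos (hdec p)).2
    have hq := (hpos (hdec q)).2
    rw [hpq] at hp
    simp only [List.length_drop] at hp hq
    have := p.2
    have := q.2
    exact Fin.ext (by omega)
  · intro i _ hi
    refine List.count_eq_zero.2 fun hmem => ?_
    obtain ⟨a, b, hab⟩ := List.append_of_mem hmem
    exact hi (hpos hab).1.symm
  · simp

theorem Represents_s14.step {π π' : Arrangement n k d} {S T : Fin k → List (Fin n)}
    (h : Represents_s14 π S) (h' : Represents_s14 π' T) (hST : PopPush d S T)
    (hd : ∀ i, (S i).length ≤ d) : Step π π' := by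
  obtain ⟨i, j, x, xs, hij, hi, hj, rfl⟩ := hST
  have hil := hd i
  rw [hi, List.length_cons] at hil
  have hx : π.pos x = (i, ⟨d - 1 - xs.length, by omega⟩) :=
    (h _ _ _).2 ⟨[], xs, hi, by simp; omega⟩
  have hx' : π'.pos x = (j, ⟨d - 1 - (S j).length, by omega⟩) :=
    (h' _ _ _).2 ⟨[], S j, by simp, by simp; omega⟩
  refine ⟨x, by simpa [hx, hx'] using hij.symm, fun o ho hoi => ?_, fun o ho => ?_⟩
  · obtain ⟨a, b, hab, hb⟩ := (h o (π.pos o).1 (π.pos o).2).1 rfl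
    rw [hoi, hx, hi] at hab
    cases a with
    | nil => simp at hab; exact absurd hab.1.symm ho
    | cons y a =>
      simp only [List.cons_append, List.cons.injEq] at hab
      have := congrArg List.length hab.2
      simp only [List.length_append, List.length_cons] at this
      rw [hx, Fin.lt_def]
      simp only
      omega
  · obtain ⟨a, b, hab, hb⟩ := (h o (π.pos o).1 (π.pos o).2).1 rfl
    refine (h' o (π.pos o).1 (π.pos o).2).2 ?_
    generalize (π.pos o).1 = r at hab
    by_cases hrj : r = j
    · subst hrj
      exact ⟨x :: a, b, by simp [hab], hb⟩
    · by_cases hri : r = i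
      · subst hri
        rw [hi] at hab
        cases a with
        | nil => simp at hab; exact absurd hab.1.symm ho
        | cons y a =>
          simp only [List.cons_append, List.cons.injEq] at hab
          exact ⟨a, b, by simp [hrj, hab.2], hb⟩
      · exact ⟨a, b, by simp [hrj, hri, hab], hb⟩

theorem Represents_s14.exists_reach {π π' : Arrangement n k d} {S T : Fin k → List (Fin n)} {m : ℕ}
    (h : Represents_s14 π S) (h' : Represents_s14 π' T) (hST : Within d m S T)
    (hd : ∀ i, (S i).length ≤ d) : ∃ m' ≤ m, Reach π π' m' := by
  induction hST generalizing π with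
  | refl m S =>
    obtain rfl := h.unique h'
    exact ⟨0, Nat.zero_le _, fun _ => π, rfl, rfl, fun t ht => absurd ht (Nat.not_lt_zero t)⟩
  | head hs _ ih =>
    have hTd := hs.length_le hd
    obtain ⟨ρ, hρ⟩ := exists_arrangement (hs.exact (h.exact hd)) hTd
    obtain ⟨m', hm', f, hf0, hfm, hf⟩ := ih hρ h' hTd
    refine ⟨m' + 1, by omega, fun t => t.casesOn π f, rfl, hfm, fun t ht => ?_⟩
    cases t with
    | zero =>
      change Step π (f 0)
      rw [hf0]
      exact h.step hρ hs hd
    | succ t => exact hf t (by omega)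

end Represents_s14

/-- A step that takes the top object of stack `p.1` to stack `p.2`. -/
def StepVia {n k d : ℕ} (p : Fin k × Fin k) (π π' : Arrangement n k d) : Prop :=
  ∃ o : Fin n, (π.pos o).1 = p.1 ∧ (π'.pos o).1 = p.2 ∧
    (∀ o' : Fin n, o' ≠ o → (π.pos o').1 = (π.pos o).1 → (π.pos o).2 < (π.pos o').2) ∧
    (∀ o' : Fin n, o' ≠ o → π'.pos o' = π.pos o')

open Classical in
/-- The arrangement obtained by the step described by `p`, if there is one. -/
noncomputable def applyStep {n k d : ℕ} (π : Arrangement n k d) (p : Option (Fin k × Fin k)) :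
    Arrangement n k d :=
  if h : ∃ π', ∃ q, p = some q ∧ StepVia q π π' then h.choose else π

section Counting

variable {n k d : ℕ}

theorem Arrangement.depth_le_of_agree {π π' : Arrangement n k d} {o : Fin n}
    (ho : (π.pos o).1 = (π'.pos o).1) (h : ∀ o', o' ≠ o → π.pos o' = π'.pos o') :
    (π'.pos o).2 ≤ (π.pos o).2 := by
  by_contra! hlt
  obtain ⟨o', ho'⟩ := π.contig o (π'.pos o).2 hlt.le
  have hne : o' ≠ o := by
    intro he
    rw [he] at ho'
    rw [ho] at ho'
    exact hlt.ne (congrArg Prod.snd ho')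
  rw [h o' hne, ho] at ho'
  exact hne (π'.inj ho')

theorem StepVia.unique {p : Fin k × Fin k} {π π' π'' : Arrangement n k d}
    (h' : StepVia p π π') (h'' : StepVia p π π'') : π' = π'' := by
  obtain ⟨o, ho, hj, htop, hrest⟩ := h'
  obtain ⟨o₂, ho₂, hj₂, htop₂, hrest₂⟩ := h''
  obtain rfl : o = o₂ := by
    by_contra hne
    exact lt_asymm (htop o₂ (Ne.symm hne) (ho₂.trans ho.symm)) (htop₂ o hne (ho.trans ho₂.symm))
  have heq (o' : Fin n) (h : o' ≠ o) : π'.pos o' = π''.pos o' :=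
    (hrest o' h).trans (hrest₂ o' h).symm
  refine Arrangement.ext_pos fun o' => ?_
  by_cases h : o' = o
  · subst h
    have hs := hj.trans hj₂.symm
    exact Prod.ext hs (le_antisymm
      (Arrangement.depth_le_of_agree hs.symm fun a ha => (heq a ha).symm)
      (Arrangement.depth_le_of_agree hs heq))
  · exact heq o' h

theorem applyStep_none (π : Arrangement n k d) : applyStep π none = π := by
  simp [applyStep]

theorem Step.exists_applyStep {π π' : Arrangement n k d} (h : Step π π') :
    ∃ p, applyStep π p = π' := by
  obtain ⟨o, -, htop, hrest⟩ := h
  have hv : StepVia ((π.pos o).1, (π'.pos o).1) π π' := ⟨o, rfl, rfl, htop, hrest⟩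
  refine ⟨some ((π.pos o).1, (π'.pos o).1), ?_⟩
  have hex : ∃ ρ, ∃ q, some ((π.pos o).1, (π'.pos o).1) = some q ∧ StepVia q π ρ :=
    ⟨_, _, rfl, hv⟩
  rw [applyStep, dif_pos hex]
  obtain ⟨q, hq, hs⟩ := hex.choose_spec
  rw [← Option.some_injective _ hq] at hs
  exact hs.unique hv

theorem Reach.exists_word {π π' : Arrangement n k d} {m B : ℕ} (h : Reach π π' m)
    (hB : m ≤ B) : ∃ l : List.Vector (Option (Fin k × Fin k)) B,
      l.toList.foldl applyStep π = π' := by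
  obtain ⟨f, rfl, rfl, hf⟩ := h
  have hm : ∃ l : List (Option (Fin k × Fin k)), l.length = m ∧
      l.foldl applyStep (f 0) = f m := by
    clear hB
    induction m with
    | zero => exact ⟨[], rfl, rfl⟩
    | succ m ih =>
      obtain ⟨l, hl, hl'⟩ := ih fun t ht => hf t (by omega)
      obtain ⟨p, hp⟩ := (hf m (by omega)).exists_applyStep
      exact ⟨l ++ [p], by simp [hl], by simp [hl', hp]⟩
  obtain ⟨l, hl, hl'⟩ := hm
  refine ⟨⟨l ++ List.replicate (B - m) none, by simp; omega⟩, ?_⟩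
  have hnone (r : ℕ) (π : Arrangement n k d) :
      (List.replicate r none).foldl applyStep π = π := by
    induction r with
    | zero => rfl
    | succ r ih => simpa [List.replicate_succ, applyStep_none] using ih
  change List.foldl applyStep (f 0) (l ++ List.replicate (B - m) none) = _
  rw [List.foldl_append, hl', hnone]

theorem exists_packed_arrangements (w d : ℕ) :
    ∃ φ : Equiv.Perm (Fin (w * d)) → Arrangement (w * d) (w + 1) d, Function.Injective φ := by
  let e : Fin (w * d) ≃ Fin w × Fin d := finProdFinEquiv.symm
  refine ⟨fun σ => ⟨fun o => ((e (σ o)).1.castSucc, (e (σ o)).2), ?_, ?_⟩, ?_⟩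
  · intro o o' h
    simp only [Prod.mk.injEq, Fin.castSucc_inj] at h
    exact σ.injective (e.injective (Prod.ext h.1 h.2))
  · intro o j _
    exact ⟨σ.symm (e.symm ((e (σ o)).1, j)), by simp⟩
  · intro σ τ h
    have h1 := congrArg Arrangement.pos h
    ext1 o
    have h2 := congrFun h1 o
    simp only [Prod.mk.injEq, Fin.castSucc_inj] at h2
    exact e.injective (Prod.ext h2.1 h2.2)

theorem factorial_le_of_reach (w d B : ℕ)
    (h : ∀ π π' : Arrangement (w * d) (w + 1) d, ∃ m ≤ B, Reach π π' m) :
    (w * d).factorial ≤ ((w + 1) * (w + 1) + 1) ^ B := by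
  obtain ⟨φ, hφ⟩ := exists_packed_arrangements w d
  have hword (σ : Equiv.Perm (Fin (w * d))) :
      ∃ l : List.Vector (Option (Fin (w + 1) × Fin (w + 1))) B,
        l.toList.foldl applyStep (φ 1) = φ σ := by
    obtain ⟨m, hm, hr⟩ := h (φ 1) (φ σ)
    exact hr.exists_word hm
  choose word hword using hword
  have hinj : Function.Injective word := by
    intro σ τ hστ
    apply hφ
    rw [← hword σ, ← hword τ, hστ]
  have := Fintype.card_le_of_injective word hinj
  simpa [Fintype.card_perm, card_vector] using this

theorem pow_self_le_factorial (d : ℕ) : d ^ d ≤ (2 * d).factorial := by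
  have h := Nat.factorial_mul_pow_le_factorial (m := d) (n := d)
  rw [← two_mul] at h
  calc d ^ d ≤ (d + 1) ^ d := Nat.pow_le_pow_left (by omega) d
    _ ≤ d.factorial * (d + 1) ^ d := Nat.le_mul_of_pos_left _ (Nat.factorial_pos d)
    _ ≤ _ := h

end Counting

/-- For every fixed `w ≥ 2` there is a constant `c > 0` such that for every
`d ≥ 1`, every LSR instance with `n = w*d` objects in `w+1` stacks of capacity `d` has a
solution of at most `c·d·(1 + log d)` permissible pop-and-push actions.  Combined with the
matching lower bound (second conjunct), for constant `w` the optimal number of actions is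
`Θ(d log d)`. -/
theorem lsr_const_w_tight (w : ℕ) (hw : 2 ≤ w) :
    ∃ c : ℝ, 0 < c ∧
      -- upper bound: every instance is solvable in at most `c·d·(1 + log d)` actions
      (∀ d : ℕ, 1 ≤ d → ∀ πI πG : Arrangement (w * d) (w + 1) d,
        ∃ m : ℕ, (m : ℝ) ≤ c * d * (1 + Real.log d) ∧ Reach πI πG m) ∧
      -- matching lower bound: some instance requires at least `c'·d·log d` actions
      (∃ c' : ℝ, 0 < c' ∧ ∀ d : ℕ, 2 ≤ d →
        ∃ πI πG : Arrangement (w * d) (w + 1) d,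
          ∀ m : ℕ, Reach πI πG m → c' * d * Real.log d ≤ (m : ℝ)) := by
  refine ⟨22 * (w + 1) ^ 2 + 8 * (w + 1) + 2, by positivity, fun d hd πI πG => ?_,
    (2 * Real.log ((w + 1) * (w + 1) + 1))⁻¹, ?_, fun d hd => ?_⟩
  · obtain ⟨S, hS, hSd⟩ := exists_represents πI
    obtain ⟨G, hG, hGd⟩ := exists_represents πG
    have hW := within_of_exact (d := d) (t := Nat.clog 2 d) (by simpa using by omega)
      (by simp [Nat.succ_mul]) (Nat.le_pow_clog (by norm_num) d) (hS.exact hSd) (hG.exact hGd)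
      hSd hGd
    obtain ⟨m, hm, hr⟩ := hS.exists_reach hG hW hSd
    refine ⟨m, ?_, hr⟩
    rw [Fintype.card_fin] at hm
    have hd' : (1 : ℝ) ≤ d := by exact_mod_cast hd
    have hlog : 0 ≤ Real.log d := Real.log_nonneg hd'
    have hclog : (Nat.clog 2 d : ℝ) ≤ 2 * (1 + Real.log d) := by
      rcases Nat.lt_or_ge 1 d with h1 | h1
      · have h2 := Nat.pow_pred_clog_lt_self (b := 2) (by norm_num) h1
        have h3 : (2 : ℝ) ^ (Nat.clog 2 d).pred ≤ d := by exact_mod_cast h2.le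
        have h4 := Real.log_le_log (by positivity) h3
        rw [Real.log_pow] at h4
        have h5 : (Nat.clog 2 d : ℝ) ≤ (Nat.clog 2 d).pred + 1 := by
          exact_mod_cast Nat.le_succ_of_pred_le le_rfl
        have h6 := Real.log_two_gt_d9
        have h7 : (0 : ℝ) ≤ (Nat.clog 2 d).pred := Nat.cast_nonneg _
        nlinarith
      · rw [Nat.clog_of_right_le_one h1]
        push_cast
        positivity
    have hm' : (m : ℝ) ≤ d + (w + 1) * ((w + 1) * (11 * d) + Nat.clog 2 d * (4 * d)) + d := by
      exact_mod_cast hm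
    have hmul : (Nat.clog 2 d : ℝ) * (4 * d) ≤ 2 * (1 + Real.log d) * (4 * d) := by gcongr
    have hw1 : (0 : ℝ) ≤ (w : ℝ) + 1 := by positivity
    calc (m : ℝ) ≤ d + (w + 1) * ((w + 1) * (11 * d) + 2 * (1 + Real.log d) * (4 * d)) + d :=
        hm'.trans (by gcongr)
      _ = (11 * (w + 1) ^ 2 + 2) * d * 1 + 8 * (w + 1) * d * (1 + Real.log d) := by ring
      _ ≤ (22 * (w + 1) ^ 2 + 2) * d * (1 + Real.log d) +
          8 * (w + 1) * d * (1 + Real.log d) := by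
        gcongr
        · norm_num
        · linarith
      _ = _ := by ring
  · have : 0 < Real.log (((w : ℝ) + 1) * (w + 1) + 1) := Real.log_pos (by
      have : (0 : ℝ) < ((w : ℝ) + 1) * (w + 1) := by positivity
      linarith)
    positivity
  · by_contra! hcon
    set L := Real.log (((w : ℝ) + 1) * (w + 1) + 1) with hL
    have hLpos : 0 < L := Real.log_pos (by
      have : (0 : ℝ) < ((w : ℝ) + 1) * (w + 1) := by positivity
      linarith)
    set X := (2 * L)⁻¹ * d * Real.log d with hX
    have hd' : (2 : ℝ) ≤ d := by exact_mod_cast hd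
    have hlog : 0 < Real.log d := Real.log_pos (by linarith)
    have hX0 : 0 ≤ X := by positivity
    have hfac := factorial_le_of_reach w d ⌊X⌋₊ fun π π' => by
      obtain ⟨m, hr, hm⟩ := hcon π π'
      exact ⟨m, Nat.le_floor hm.le, hr⟩
    have hpow : d ^ d ≤ ((w + 1) * (w + 1) + 1) ^ ⌊X⌋₊ :=
      (pow_self_le_factorial d).trans ((Nat.factorial_le (Nat.mul_le_mul_right d hw)).trans hfac)
    have hpow' : (d : ℝ) ^ d ≤ (((w : ℝ) + 1) * (w + 1) + 1) ^ ⌊X⌋₊ := by exact_mod_cast hpow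
    have h1 := Real.log_le_log (by positivity) hpow'
    rw [Real.log_pow, Real.log_pow, ← hL] at h1
    have h2 : (⌊X⌋₊ : ℝ) * L ≤ X * L :=
      mul_le_mul_of_nonneg_right (Nat.floor_le hX0) hLpos.le
    have h3 : X * L = d * Real.log d / 2 := by
      rw [hX]; field_simp
    have h4 : 0 < d * Real.log d := by positivity
    linarith
end

section
/- The column-based heuristic CBH is admissible: for every pair of arrangements π_C and π_G of n objects in w+1 stacks of capacity d, CBH(π_C, π_G) is less than or equal to the cost of every solution of the LSR instance (π_C, π_G). -/
/-- The column-based heuristic `CBH(π_C, π_G) = Σ_o h(o)`.  Depths here are 0-based, so the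
1-based condition `(w+1)d − n < π_C²(o) + π_G²(o) − 1` reads
`(w+1)·d < (π_C²(o) + π_G²(o) + 1) + n`. -/
def CBH {n w d : ℕ} (πC πG : Arrangement n (w + 1) d) : ℕ :=
  ∑ o : Fin n,
    if (πC.pos o).1 = (πG.pos o).1 then
      (if ∃ o' : Fin n, (πC.pos o').1 = (πC.pos o).1 ∧ (πC.pos o).2 < (πC.pos o').2 ∧
          πC.pos o' ≠ πG.pos o' then 2 else 0)
    else
      (if (w + 1) * d < ((πC.pos o).2 : ℕ) + ((πG.pos o).2 : ℕ) + 1 + n then 2 else 1)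

/-- A step that keeps the stack of an object keeps its position. -/
lemma Step.pos_eq {n k d : ℕ} {π π' : Arrangement n k d} (h : Step π π') {o : Fin n}
    (ho : (π'.pos o).1 = (π.pos o).1) : π'.pos o = π.pos o := by
  obtain ⟨a, ha, -, hrest⟩ := h
  refine hrest o ?_
  rintro rfl
  exact ha ho

/-- At most one object changes its stack in a step. -/
lemma Step.eq_of_moves {n k d : ℕ} {π π' : Arrangement n k d} (h : Step π π') {o o' : Fin n}
    (ho : (π'.pos o).1 ≠ (π.pos o).1) (ho' : (π'.pos o').1 ≠ (π.pos o').1) : o = o' := by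
  obtain ⟨a, -, -, hrest⟩ := h
  have key : ∀ b, (π'.pos b).1 ≠ (π.pos b).1 → b = a := fun b hb => by
    by_contra hne
    exact hb (congrArg Prod.fst (hrest b hne))
  rw [key o ho, key o' ho']

/-- The object moved in a step is the top of its stack. -/
lemma Step.lt_of_moves {n k d : ℕ} {π π' : Arrangement n k d} (h : Step π π') {o : Fin n}
    (ho : (π'.pos o).1 ≠ (π.pos o).1) {o' : Fin n} (hne : o' ≠ o)
    (hs : (π.pos o').1 = (π.pos o).1) : (π.pos o).2 < (π.pos o').2 := by
  obtain ⟨a, -, htop, hrest⟩ := h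
  have : o = a := by
    by_contra hne
    exact ho (congrArg Prod.fst (hrest o hne))
  subst this
  exact htop o' hne hs

/-- The cells above the moved object, together with the cells weakly above its landing position,
are all free before the move. -/
lemma Step.depth_add_depth_le {n k d : ℕ} {π π' : Arrangement n k d} (h : Step π π') {o : Fin n}
    (ho : (π'.pos o).1 ≠ (π.pos o).1) :
    ((π.pos o).2 : ℕ) + ((π'.pos o).2 : ℕ) + 1 + n ≤ k * d := by
  classical
  have hother : ∀ o', o' ≠ o → π'.pos o' = π.pos o' := fun o' hne =>
    h.pos_eq (by_contra fun hm => hne (h.eq_of_moves hm ho))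
  have hland : ∀ a, π.pos a ≠ π'.pos o := by
    intro a ha
    by_cases hao : a = o
    · subst hao
      exact ho (congrArg Prod.fst ha).symm
    · exact hao (π'.inj ((hother a hao).trans ha))
  let A : Finset (Fin k × Fin d) := Finset.univ.image π.pos
  let B : Finset (Fin k × Fin d) := {(π.pos o).1} ×ˢ Finset.Iio (π.pos o).2
  let C : Finset (Fin k × Fin d) := {(π'.pos o).1} ×ˢ Finset.Iic (π'.pos o).2
  have hAB : Disjoint A B := by
    rw [Finset.disjoint_left]
    intro x hxA hxB
    obtain ⟨a, -, rfl⟩ := Finset.mem_image.1 hxA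
    obtain ⟨h1, h2⟩ := Finset.mem_product.1 hxB
    rw [Finset.mem_singleton] at h1
    rw [Finset.mem_Iio] at h2
    have hne : a ≠ o := by
      rintro rfl
      exact lt_irrefl _ h2
    exact lt_asymm h2 (h.lt_of_moves ho hne h1)
  have hABC : Disjoint (A ∪ B) C := by
    rw [Finset.disjoint_left]
    intro x hx hxC
    obtain ⟨h1, h2⟩ := Finset.mem_product.1 hxC
    rw [Finset.mem_singleton] at h1
    rw [Finset.mem_Iic] at h2
    rcases Finset.mem_union.1 hx with hxA | hxB
    · obtain ⟨a, -, rfl⟩ := Finset.mem_image.1 hxA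
      obtain ⟨b, hb⟩ := π.contig a _ h2
      exact hland b (hb.trans (Prod.ext h1 rfl))
    · have h3 := (Finset.mem_product.1 hxB).1
      rw [Finset.mem_singleton] at h3
      exact ho (h1.symm.trans h3)
  have hcard := Finset.card_le_univ (A ∪ B ∪ C)
  rw [Finset.card_union_of_disjoint hABC, Finset.card_union_of_disjoint hAB] at hcard
  simp only [A, B, C, Finset.card_image_of_injective _ π.inj, Finset.card_univ, Fintype.card_fin,
    Finset.card_product, Finset.card_singleton, Fin.card_Iio, Fin.card_Iic,
    Fintype.card_prod] at hcard
  omega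

/-- The times before `m` at which the object `o` changes its stack. -/
def moveTimes {n k d : ℕ} (f : ℕ → Arrangement n k d) (m : ℕ) (o : Fin n) : Finset ℕ :=
  {t ∈ Finset.range m | ((f (t + 1)).pos o).1 ≠ ((f t).pos o).1}

lemma mem_moveTimes {n k d : ℕ} {f : ℕ → Arrangement n k d} {m : ℕ} {o : Fin n} {t : ℕ} :
    t ∈ moveTimes f m o ↔ t < m ∧ ((f (t + 1)).pos o).1 ≠ ((f t).pos o).1 := by
  simp [moveTimes]

/-- Every action moves one object, so the numbers of moves add up to at most the cost. -/
lemma sum_card_moveTimes_le {n k d : ℕ} {f : ℕ → Arrangement n k d} {m : ℕ}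
    (hf : ∀ t, t < m → Step (f t) (f (t + 1))) : ∑ o, (moveTimes f m o).card ≤ m := by
  rw [← Finset.card_sigma]
  calc _ ≤ (Finset.range m).card := by
        refine Finset.card_le_card_of_injOn (fun x => x.2) ?_ ?_
        · rintro ⟨o, t⟩ hx
          simp only [Finset.coe_sigma, Set.mem_sigma_iff, Finset.mem_coe, mem_moveTimes] at hx
          simpa using hx.2.1
        · rintro ⟨o, t⟩ hx ⟨o', t'⟩ hx' (rfl : t = t')
          simp only [Finset.coe_sigma, Set.mem_sigma_iff, Finset.mem_coe, mem_moveTimes] at hx hx'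
          obtain rfl := (hf t hx.2.1).eq_of_moves hx.2.2 hx'.2.2
          rfl
    _ = m := Finset.card_range m

/-- An object that does not move during an interval of time keeps its position. -/
lemma pos_eq_of_not_mem_moveTimes {n k d : ℕ} {f : ℕ → Arrangement n k d} {m : ℕ}
    (hf : ∀ t, t < m → Step (f t) (f (t + 1))) {o : Fin n} {a b : ℕ} (hab : a ≤ b) (hb : b ≤ m)
    (h : ∀ t, a ≤ t → t < b → t ∉ moveTimes f m o) : (f b).pos o = (f a).pos o := by
  induction b, hab using Nat.le_induction with
  | base => rfl
  | succ b hab ih =>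
    rw [← ih (by omega) fun t h1 h2 => h t h1 (by omega)]
    refine (hf b hb).pos_eq ?_
    by_contra hm
    exact h b hab (by omega) (mem_moveTimes.2 ⟨hb, hm⟩)

/-- An object that moves at most once goes directly from its initial to its final position. -/
lemma pos_eq_of_card_moveTimes_le_one {n k d : ℕ} {f : ℕ → Arrangement n k d} {m : ℕ}
    (hf : ∀ t, t < m → Step (f t) (f (t + 1))) {o : Fin n} (hc : (moveTimes f m o).card ≤ 1)
    {t : ℕ} (ht : t ∈ moveTimes f m o) :
    (f t).pos o = (f 0).pos o ∧ (f (t + 1)).pos o = (f m).pos o := by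
  have huniq := fun s hs => Finset.card_le_one.1 hc s hs t ht
  have htm := (mem_moveTimes.1 ht).1
  constructor
  · refine pos_eq_of_not_mem_moveTimes hf t.zero_le htm.le fun s _ h2 hs => ?_
    have := huniq s hs
    omega
  · refine (pos_eq_of_not_mem_moveTimes hf htm le_rfl fun s h1 _ hs => ?_).symm
    have := huniq s hs
    omega

/-- An object whose final position differs from its initial one moves at least once. -/
lemma moveTimes_nonempty {n k d : ℕ} {f : ℕ → Arrangement n k d} {m : ℕ}
    (hf : ∀ t, t < m → Step (f t) (f (t + 1))) {o : Fin n}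
    (h : (f 0).pos o ≠ (f m).pos o) : (moveTimes f m o).Nonempty := by
  by_contra hempty
  rw [Finset.not_nonempty_iff_eq_empty] at hempty
  exact h (pos_eq_of_not_mem_moveTimes hf m.zero_le le_rfl (by simp [hempty])).symm

/-- An object lying above a displaced object moves at least once. -/
lemma moveTimes_nonempty_of_above {n k d : ℕ} {f : ℕ → Arrangement n k d} {m : ℕ}
    (hf : ∀ t, t < m → Step (f t) (f (t + 1))) {o o' : Fin n}
    (hs : ((f 0).pos o').1 = ((f 0).pos o).1) (hlt : ((f 0).pos o).2 < ((f 0).pos o').2)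
    (h : (f 0).pos o' ≠ (f m).pos o') : (moveTimes f m o).Nonempty := by
  have hne := moveTimes_nonempty hf h
  set t := (moveTimes f m o').min' hne with ht
  have htm := mem_moveTimes.1 (Finset.min'_mem _ hne)
  rw [← ht] at htm
  have hpos' : (f t).pos o' = (f 0).pos o' :=
    pos_eq_of_not_mem_moveTimes hf t.zero_le htm.1.le fun s _ h2 hs' =>
      absurd (Finset.min'_le _ s hs') (by omega)
  by_contra hempty
  rw [Finset.not_nonempty_iff_eq_empty] at hempty
  have hpos : (f t).pos o = (f 0).pos o :=
    pos_eq_of_not_mem_moveTimes hf t.zero_le htm.1.le (by simp [hempty])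
  have hoo : o ≠ o' := by
    rintro rfl
    exact lt_irrefl _ hlt
  have := (hf t htm.1).lt_of_moves htm.2 hoo (by rw [hpos, hpos', hs])
  rw [hpos, hpos'] at this
  exact lt_asymm this hlt

/-- The column-based heuristic is admissible: `CBH(π_C, π_G)` is at most the
cost of every solution of the LSR instance `(π_C, π_G)`. -/
theorem cbh_admissible (w d n : ℕ) (hw : 2 ≤ w) (hd : 1 ≤ d)
    (πC πG : Arrangement n (w + 1) d) :
    ∀ m : ℕ, Reach πC πG m → CBH πC πG ≤ m := by
  rintro m ⟨f, rfl, rfl, hf⟩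
  refine le_trans (Finset.sum_le_sum fun o _ => ?_) (sum_card_moveTimes_le hf)
  split_ifs with hstack habove hspace
  · obtain ⟨o', hs, hlt, hne⟩ := habove
    obtain ⟨t, ht⟩ := moveTimes_nonempty_of_above hf hs hlt hne
    by_contra hc
    obtain ⟨h1, h2⟩ := pos_eq_of_card_moveTimes_le_one hf (by omega) ht
    exact (mem_moveTimes.1 ht).2 (by rw [h1, h2, hstack])
  · exact Nat.zero_le _
  · obtain ⟨t, ht⟩ := moveTimes_nonempty hf fun h => hstack (congrArg Prod.fst h)
    by_contra hc
    obtain ⟨h1, h2⟩ := pos_eq_of_card_moveTimes_le_one hf (by omega) ht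
    obtain ⟨htm, hm⟩ := mem_moveTimes.1 ht
    have := (hf t htm).depth_add_depth_le hm
    rw [h1, h2] at this
    omega
  · exact (moveTimes_nonempty hf fun h => hstack (congrArg Prod.fst h)).card_pos
end
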